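/- arXiv:1401.4197 — 4 statements merged into one kernel-verified Lean document; each statement's English description precedes it below -/
import Mathlib

section
/- Let d ≥ 3 be a natural number and let T be a simple graph on a nonempty vertex set V that is connected, acyclic, and d-regular (every vertex has degree d), i.e., T is the d-regular tree. Then there exists exactly one probability measure μ on the space {0,1}^{E(T)} of functions from the edge set of T to {0,1}, equipped with the product σ-algebra, such that (i) μ assigns full measure to the set of indicator functions of perfect matchings of T, and (ii) μ is invariant under the pushforward action of every graph automorphism of T on {0,1}^{E(T)}. -/
open MeasureTheory

namespace SimpleGraph

open scoped ENNReal

variable {V : Type} {T : SimpleGraph V} {r v w : V} {d : ℕ}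

open Classical in
/-- The neighbour of `v` that is closer to the root `r`; the root is its own parent. -/
noncomputable def parent (T : SimpleGraph V) (r v : V) : V :=
  if h : ∃ w, T.Adj v w ∧ T.dist r w < T.dist r v then h.choose else v

/-- The vertices whose parent is `v`, when the graph is rooted at `r`. -/
def children (T : SimpleGraph V) (r v : V) : Set V := {w | w ≠ r ∧ T.parent r w = v}

@[simp] lemma parent_self : T.parent r r = r := by
  simp [parent]

namespace IsTree

lemma exists_closer (hT : T.IsTree) (hv : v ≠ r) :
    ∃ w, T.Adj v w ∧ T.dist r w < T.dist r v := by
  obtain ⟨p, hp⟩ := hT.connected.exists_walk_length_eq_dist r v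
  have hn : ¬ p.Nil := fun h => hv h.eq.symm
  refine ⟨p.penultimate, (p.adj_penultimate hn).symm, ?_⟩
  have h1 := dist_le p.dropLast
  have h2 := p.length_dropLast_add_one hn
  omega

lemma adj_parent (hT : T.IsTree) (hv : v ≠ r) : T.Adj v (T.parent r v) := by
  rw [parent, dif_pos (hT.exists_closer hv)]
  exact (hT.exists_closer hv).choose_spec.1

lemma dist_parent_add_one (hT : T.IsTree) (hv : v ≠ r) :
    T.dist r (T.parent r v) + 1 = T.dist r v := by
  have h1 : T.dist r (T.parent r v) < T.dist r v := by
    rw [parent, dif_pos (hT.exists_closer hv)]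
    exact (hT.exists_closer hv).choose_spec.2
  have := hT.dist_eq_dist_add_one_of_adj r (hT.adj_parent hv)
  omega

lemma eq_of_adj_of_dist_lt (hT : T.IsTree) {u : V} (hu : T.Adj v u) (hw : T.Adj v w)
    (hu' : T.dist r u < T.dist r v) (hw' : T.dist r w < T.dist r v) : u = w := by
  have key : ∀ x, T.Adj v x → T.dist r x < T.dist r v →
      ∃ p : T.Walk r v, p.IsPath ∧ p.penultimate = x := by
    intro x hx hx'
    obtain ⟨p, hp⟩ := hT.connected.exists_walk_length_eq_dist r x
    refine ⟨p.concat hx.symm, Walk.isPath_of_length_eq_dist _ ?_, by simp⟩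
    have := hT.dist_eq_dist_add_one_of_adj r hx
    rw [Walk.length_concat]
    omega
  obtain ⟨p, hp, rfl⟩ := key u hu hu'
  obtain ⟨q, hq, rfl⟩ := key w hw hw'
  rw [(hT.existsUnique_path r v).unique hp hq]

lemma adj_iff_parent (hT : T.IsTree) (r : V) :
    T.Adj v w ↔ (v ≠ r ∧ T.parent r v = w) ∨ (w ≠ r ∧ T.parent r w = v) := by
  have key : ∀ x y, T.Adj x y → T.dist r y < T.dist r x → x ≠ r ∧ T.parent r x = y := by
    intro x y hxy hlt
    have hx : x ≠ r := by rintro rfl; simp at hlt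
    have := hT.dist_parent_add_one hx
    exact ⟨hx, hT.eq_of_adj_of_dist_lt (hT.adj_parent hx) hxy (by omega) hlt⟩
  constructor
  · intro h
    rcases lt_or_gt_of_ne (hT.dist_ne_of_adj r h) with h' | h'
    · exact .inr (key _ _ h.symm h')
    · exact .inl (key _ _ h h')
  · rintro (⟨h, rfl⟩ | ⟨h, rfl⟩)
    · exact hT.adj_parent h
    · exact (hT.adj_parent h).symm

lemma parent_ne_of_parent_eq (hT : T.IsTree) (hv : v ≠ r) (h : T.parent r v = w) :
    T.parent r w ≠ v := by
  rintro rfl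
  have h1 := hT.dist_parent_add_one hv
  by_cases hw : w = r
  · subst hw; simp at hv
  · have h2 := hT.dist_parent_add_one hw
    rw [h] at h1
    omega

lemma mem_children_iff (hT : T.IsTree) :
    w ∈ T.children r v ↔ T.Adj v w ∧ w ≠ T.parent r v := by
  rw [hT.adj_iff_parent r]
  constructor
  · rintro ⟨h1, h2⟩
    exact ⟨.inr ⟨h1, h2⟩, fun h => hT.parent_ne_of_parent_eq h1 h2 h.symm⟩
  · rintro ⟨h | h, h'⟩
    · exact absurd h.2.symm h'
    · exact h

lemma dist_of_mem_children (hT : T.IsTree) (h : w ∈ T.children r v) :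
    T.dist r w = T.dist r v + 1 := by
  rw [← hT.dist_parent_add_one h.1, h.2]

lemma children_root (hT : T.IsTree) : T.children r r = T.neighborSet r := by
  ext w
  rw [hT.mem_children_iff, parent_self, mem_neighborSet]
  exact and_iff_left_of_imp fun h => h.ne.symm

lemma children_of_ne (hT : T.IsTree) :
    T.children r v = T.neighborSet v \ {T.parent r v} := by
  ext w
  rw [hT.mem_children_iff]
  simp

lemma ncard_children (hT : T.IsTree) (hreg : ∀ v : V, (T.neighborSet v).ncard = d) (hv : v ≠ r) :
    (T.children r v).ncard = d - 1 := by
  rw [hT.children_of_ne, Set.ncard_sdiff_singleton_of_mem (by exact hT.adj_parent hv), hreg]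

/-- Recursion along the distance to the root. -/
lemma exists_rec (hT : T.IsTree) (r : V) {α : Type*} (base : α) (step : V → α → α) :
    ∃ φ : V → α, φ r = base ∧ ∀ v, v ≠ r → φ v = step v (φ (T.parent r v)) := by
  let Φ : ℕ → V → α := fun n => n.rec (fun _ => base) fun _ f v => step v (f (T.parent r v))
  refine ⟨fun v => Φ (T.dist r v) v, by simp [Φ], fun v hv => ?_⟩
  simp only [← hT.dist_parent_add_one hv]
  rfl

/-- Induction along the distance to the root. -/
lemma parent_induction (hT : T.IsTree) (r : V) {P : V → Prop} (root : P r)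
    (step : ∀ v, v ≠ r → P (T.parent r v) → P v) (v : V) : P v := by
  induction h : T.dist r v using Nat.strong_induction_on generalizing v with
  | _ n ih =>
    by_cases hv : v = r
    · exact hv ▸ root
    · have := hT.dist_parent_add_one hv
      exact step v hv (ih _ (by omega) _ rfl)

/-- Vertices at the same distance from the root have the same number of children. -/
lemma exists_bijOn_children (hT : T.IsTree) (hd : d ≠ 0)
    (hreg : ∀ v : V, (T.neighborSet v).ncard = d) (h : T.dist r v = T.dist r w) :
    ∃ e : V → V, Set.BijOn e (T.children r v) (T.children r w) := by
  have hfin : ∀ x, (T.neighborSet x).Finite := fun x =>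
    Set.finite_of_ncard_pos (by rw [hreg]; omega)
  have hfin' : ∀ x, (T.children r x).Finite := fun x => by
    rw [hT.children_of_ne]
    exact (hfin x).subset Set.sdiff_subset
  have : Nonempty V := ⟨r⟩
  refine (hfin' v).exists_bijOn_of_encard_eq ?_
  rw [← (hfin' v).cast_ncard_eq, ← (hfin' w).cast_ncard_eq]
  by_cases hv : v = r
  · subst hv
    have : v = w := by
      rw [← hT.connected.dist_eq_zero_iff, ← h, dist_self]
    rw [this]
  · have hw : w ≠ r := by
      rintro rfl
      rw [dist_self, hT.connected.dist_eq_zero_iff] at h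
      exact hv h.symm
    rw [hT.ncard_children hreg hv, hT.ncard_children hreg hw]

/-- A family of bijections between the sets of children of vertices at equal distance from the
root extends to an automorphism. -/
lemma exists_iso_of_bijOn_children (hT : T.IsTree) (r : V) (e : V → V → V → V)
    (he : ∀ u u', T.dist r u = T.dist r u' →
      Set.BijOn (e u u') (T.children r u) (T.children r u')) :
    ∃ g : T ≃g T, g r = r ∧ ∀ u v, v ∈ T.children r u → g v = e u (g u) v := by
  obtain ⟨φ, h0, hs⟩ := hT.exists_rec r r fun v y => e (T.parent r v) y v
  have hdist : ∀ v, T.dist r (φ v) = T.dist r v := by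
    refine hT.parent_induction r (by rw [h0]) fun v hv ih => ?_
    have := (he _ _ ih.symm).mapsTo ⟨hv, rfl⟩
    rw [← hs v hv] at this
    rw [hT.dist_of_mem_children this, ih, hT.dist_parent_add_one hv]
  have hmem : ∀ v, v ≠ r → φ v ∈ T.children r (φ (T.parent r v)) := by
    intro v hv
    rw [hs v hv]
    exact (he _ _ (hdist _).symm).mapsTo ⟨hv, rfl⟩
  have hroot : ∀ v, φ v = r → v = r := fun v hv => by
    by_contra h
    exact (hmem v h).1 hv
  have hinj : ∀ v w, φ v = φ w → v = w := by
    refine hT.parent_induction r (fun w h => (hroot w (by rw [← h, h0])).symm) fun v hv ih w h => ?_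
    have hw : w ≠ r := by
      rintro rfl
      exact hv (hroot v (by rw [h, h0]))
    have hp : T.parent r v = T.parent r w := by
      apply ih
      rw [← (hmem v hv).2, ← (hmem w hw).2, h]
    rw [hs v hv, hs w hw, ← hp] at h
    exact (he _ _ (hdist _).symm).injOn ⟨hv, rfl⟩ ⟨hw, hp.symm⟩ h
  have hsurj : ∀ w, ∃ v, φ v = w := by
    refine hT.parent_induction r ⟨r, h0⟩ fun w hw ⟨u, hu⟩ => ?_
    obtain ⟨v, hv, hvw⟩ := (he u (φ u) (hdist u).symm).surjOn
      (show w ∈ T.children r (φ u) from ⟨hw, hu.symm⟩)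
    refine ⟨v, ?_⟩
    rw [hs v hv.1, hv.2, hvw]
  refine ⟨⟨Equiv.ofBijective φ ⟨fun v w => hinj v w, hsurj⟩, ?_⟩, h0, ?_⟩
  · have key : ∀ x y, (φ x ≠ r ∧ T.parent r (φ x) = φ y) ↔ (x ≠ r ∧ T.parent r x = y) := by
      intro x y
      have hx : φ x ≠ r ↔ x ≠ r := not_congr ⟨hroot x, fun h => by rw [h, h0]⟩
      rw [hx]
      refine and_congr_right fun h => ?_
      rw [(hmem x h).2]
      exact ⟨hinj _ _, fun h => by rw [h]⟩
    intro x y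
    rw [hT.adj_iff_parent r, hT.adj_iff_parent r]
    exact or_congr (key x y) (key y x)
  · rintro u v ⟨hv, rfl⟩
    exact hs v hv

/-- Two branches at the same vertex can be exchanged by an automorphism fixing all vertices that
are not further away from the root, and all their other children. -/
lemma exists_iso_swap (hT : T.IsTree) (hd : d ≠ 0) (hreg : ∀ v : V, (T.neighborSet v).ncard = d)
    {x c c' : V} (hc : c ∈ T.children r x) (hc' : c' ∈ T.children r x) :
    ∃ g : T ≃g T, (∀ v, T.dist r v ≤ T.dist r x → g v = v) ∧ g c = c' ∧
      ∀ v w, T.dist r v ≤ T.dist r x → v ≠ x → T.Adj v w → g w = w := by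
  classical
  choose e he using fun (u u' : V) (h : T.dist r u = T.dist r u') =>
    hT.exists_bijOn_children (r := r) hd hreg h
  let E : V → V → V → V := fun u u' =>
    if u = u' then (if u = x then Equiv.swap c c' else id)
    else if h : T.dist r u = T.dist r u' then e u u' h else id
  have hE : ∀ u u', T.dist r u = T.dist r u' →
      Set.BijOn (E u u') (T.children r u) (T.children r u') := by
    intro u u' h
    by_cases huu : u = u'
    · subst huu
      by_cases hux : u = x
      · subst hux
        simp only [E, if_true]
        have hm : Set.MapsTo (Equiv.swap c c') (T.children r u) (T.children r u) := by
          intro y hy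
          rw [Equiv.swap_apply_def]
          split_ifs <;> assumption
        exact ⟨hm, (Equiv.injective _).injOn, fun y hy => ⟨Equiv.swap c c' y, hm hy, by simp⟩⟩
      · simpa [E, hux] using Set.bijOn_id _
    · simpa [E, huu, h] using he u u' h
  obtain ⟨g, hg0, hg⟩ := hT.exists_iso_of_bijOn_children r E hE
  have hfix : ∀ v, T.dist r v ≤ T.dist r x → g v = v := by
    refine hT.parent_induction r (fun _ => hg0) fun v hv ih hvx => ?_
    have h1 := hT.dist_parent_add_one hv
    have h2 : T.parent r v ≠ x := by
      intro h
      rw [h] at h1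
      omega
    rw [hg _ v ⟨hv, rfl⟩, ih (by omega)]
    simp [E, h2]
  refine ⟨g, hfix, ?_, fun v w hv hvx hvw => ?_⟩
  · rw [hg x c hc, hfix x le_rfl]
    simp [E]
  · rcases (hT.adj_iff_parent r).1 hvw with ⟨h1, h2⟩ | h
    · have := hT.dist_parent_add_one h1
      rw [h2] at this
      exact hfix w (by omega)
    · rw [hg v w h, hfix v hv]
      simp [E, hvx]

lemma finite_dist_le (hT : T.IsTree) (hfin : ∀ v, (T.neighborSet v).Finite) (r : V) (n : ℕ) :
    {v | T.dist r v ≤ n}.Finite := by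
  induction n with
  | zero =>
    refine (Set.finite_singleton r).subset fun v hv => ?_
    simpa [hT.connected.dist_eq_zero_iff, eq_comm] using hv
  | succ n ih =>
    refine (ih.union (ih.biUnion fun v _ => hfin v)).subset fun v hv => ?_
    by_cases hvr : v = r
    · left; simp [hvr]
    · right
      have := hT.dist_parent_add_one hvr
      simp only [Set.mem_ofPred_eq] at hv
      exact Set.mem_biUnion (x := T.parent r v) (by simp; omega) (hT.adj_parent hvr).symm

lemma countable_of_finite_neighborSet (hT : T.IsTree)
    (hfin : ∀ v, (T.neighborSet v).Finite) : Countable V := by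
  obtain ⟨r⟩ := hT.connected.nonempty
  rw [← Set.countable_univ_iff]
  refine (Set.countable_iUnion fun n => (hT.finite_dist_le hfin r n).countable).mono fun v _ => ?_
  exact Set.mem_iUnion.2 ⟨T.dist r v, by simp⟩

end IsTree

/-- `f` sends every vertex to its partner in some perfect matching of `T`. -/
def IsPartner (T : SimpleGraph V) (f : V → V) : Prop := ∀ v, T.Adj v (f v) ∧ f (f v) = v

open Classical in
/-- The probability that a random perfect matching agrees with `a` on `S`. -/
noncomputable def matchingWeight (T : SimpleGraph V) (r : V) (S : Finset V) (a : V → V) : ℝ≥0∞ :=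
  ∏ v ∈ S, if a v = T.parent r v then 1 else ((T.children r v).ncard : ℝ≥0∞)⁻¹

open Classical in
/-- The weight of a partial matching does not depend on the root. -/
lemma IsTree.matchingWeight_eq (hT : T.IsTree) (hreg : ∀ v : V, (T.neighborSet v).ncard = d)
    {S : Finset V} (hr : r ∈ S) (hS : ∀ v ∈ S, T.parent r v ∈ S) {a : V → V}
    (ha : T.IsPartner a) :
    T.matchingWeight r S a = (d : ℝ≥0∞)⁻¹ *
      (((d - 1 : ℕ) : ℝ≥0∞)⁻¹) ^ (S.card - 1 - (S.filter fun v => a v ∈ S).card / 2) := by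
  have har : a r ≠ T.parent r r := by
    rw [parent_self]
    exact (ha r).1.ne.symm
  have hcard : (S.filter fun v => a v ∈ S).card =
      2 * (S.filter fun v => a v = T.parent r v).card := by
    rw [← Finset.card_filter_add_card_filter_not (s := S.filter fun v => a v ∈ S)
      (fun v => a v = T.parent r v), Finset.filter_filter, Finset.filter_filter, two_mul]
    have h1 : (S.filter fun v => a v ∈ S ∧ a v = T.parent r v) =
        S.filter fun v => a v = T.parent r v :=
      Finset.filter_congr fun v hv => and_iff_right_of_imp fun h => h ▸ hS v hv
    rw [h1]
    congr 1
    refine Finset.card_nbij' a a ?_ ?_ (fun v _ => (ha v).2) (fun v _ => (ha v).2)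
    · intro v hv
      simp only [Finset.coe_filter, Set.mem_ofPred_eq] at hv ⊢
      refine ⟨hv.2.1, ?_⟩
      rw [(ha v).2]
      rcases (hT.adj_iff_parent r).1 (ha v).1 with h | h
      · exact absurd h.2.symm hv.2.2
      · exact h.2.symm
    · intro v hv
      simp only [Finset.coe_filter, Set.mem_ofPred_eq] at hv ⊢
      have hvr : v ≠ r := by
        rintro rfl
        exact har hv.2
      rw [(ha v).2]
      exact ⟨hv.2 ▸ hS v hv.1, hv.1,
        fun h => hT.parent_ne_of_parent_eq hvr rfl (by rw [← hv.2, ← h])⟩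
  have hsplit := Finset.card_filter_add_card_filter_not (s := S) (fun v => a v = T.parent r v)
  rw [hcard, Nat.mul_div_cancel_left _ two_pos]
  have hmem : r ∈ S.filter fun v => ¬ a v = T.parent r v := Finset.mem_filter.2 ⟨hr, har⟩
  have hpos := Finset.card_pos.2 ⟨r, hmem⟩
  rw [matchingWeight, Finset.prod_ite, Finset.prod_const_one, one_mul,
    ← Finset.mul_prod_erase _ _ hmem, hT.children_root, hreg]
  congr 1
  rw [Finset.prod_congr rfl (g := fun _ => ((d - 1 : ℕ) : ℝ≥0∞)⁻¹), Finset.prod_const,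
    Finset.card_erase_of_mem hmem]
  · congr 1
    omega
  · intro v hv
    rw [hT.ncard_children hreg (Finset.ne_of_mem_erase hv)]

section Measure

variable [MeasurableSpace V] [DiscreteMeasurableSpace V] [Countable V]

lemma measurableSet_agree (S : Finset V) (a : V → V) :
    MeasurableSet {f : V → V | ∀ v ∈ S, f v = a v} := by
  have : {f : V → V | ∀ v ∈ S, f v = a v} = ⋂ v ∈ S, (fun f => f v) ⁻¹' {a v} := by
    ext f; simp
  rw [this]
  exact Finset.measurableSet_biInter _ fun v _ =>
    measurable_pi_apply v (measurableSet_singleton _)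

lemma measurableSet_isPartner (T : SimpleGraph V) : MeasurableSet {f | T.IsPartner f} := by
  have : {f | T.IsPartner f} = ⋂ v, ⋃ w, ((fun f : V → V => f v) ⁻¹' ({w} ∩ {w | T.Adj v w}) ∩
      (fun f => f w) ⁻¹' {v}) := by
    ext f
    simp [IsPartner]
  rw [this]
  exact .iInter fun v => .iUnion fun w => (measurable_pi_apply v .of_discrete).inter
    (measurable_pi_apply w .of_discrete)

/-- A probability measure on partner functions is determined by the probabilities of agreeing with
a given partner function on finite sets. -/
lemma IsPartner.measure_ext {ν ν' : Measure (V → V)} [IsFiniteMeasure ν] [IsFiniteMeasure ν']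
    (hν : ∀ᵐ f ∂ν, T.IsPartner f) (hν' : ∀ᵐ f ∂ν', T.IsPartner f)
    (h : ∀ I : Finset V, ∃ S : Finset V, I ⊆ S ∧ ∀ a, T.IsPartner a →
      ν {f | ∀ v ∈ S, f v = a v} = ν' {f | ∀ v ∈ S, f v = a v}) : ν = ν' := by
  have hlim : IsProjectiveLimit ν fun I : Finset V => ν.map I.restrict := fun I => rfl
  refine hlim.unique fun I => ?_
  obtain ⟨S, hIS, hS⟩ := h I
  have hm : ∀ J : Finset V, Measurable (J.restrict : (V → V) → J → V) :=
    fun J => Finset.measurable_restrict J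
  have hm₂ : Measurable (Finset.restrict₂ (π := fun _ => V) hIS) :=
    Finset.measurable_restrict₂ hIS
  have key : ν'.map (S.restrict : (V → V) → S → V) = ν.map S.restrict := by
    refine Measure.ext_of_singleton fun b => ?_
    rw [Measure.map_apply (hm S) (measurableSet_singleton _),
      Measure.map_apply (hm S) (measurableSet_singleton _)]
    by_cases hb : ∃ a, T.IsPartner a ∧ S.restrict a = b
    · obtain ⟨a, ha, rfl⟩ := hb
      have : (S.restrict : (V → V) → S → V) ⁻¹' {S.restrict a} =
          {f : V → V | ∀ v ∈ S, f v = a v} := by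
        ext f
        simp [funext_iff]
      rw [this, hS a ha]
    · have hnull : (S.restrict : (V → V) → S → V) ⁻¹' {b} ⊆ {f | ¬ T.IsPartner f} :=
        fun f hf hp => hb ⟨f, hp, hf⟩
      rw [measure_mono_null hnull hν, measure_mono_null hnull hν']
  change ν'.map (I.restrict : (V → V) → I → V) = ν.map I.restrict
  have hcomp : (I.restrict : (V → V) → I → V) = Finset.restrict₂ hIS ∘ S.restrict := rfl
  rw [hcomp, ← Measure.map_map hm₂ (hm S), ← Measure.map_map hm₂ (hm S), key]

/-- An invariant measure on partner functions gives the event of agreeing with `a` on `S` the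
probability `matchingWeight`. -/
lemma IsTree.measure_agree_of_invariant (hT : T.IsTree) (hd : d ≠ 0)
    (hreg : ∀ v : V, (T.neighborSet v).ncard = d) {ν : Measure (V → V)} [IsProbabilityMeasure ν]
    (hν : ∀ᵐ f ∂ν, T.IsPartner f)
    (hinv : ∀ g : T ≃g T, ν.map (fun f v => g (f (g.symm v))) = ν)
    {a : V → V} (ha : T.IsPartner a) (S : Finset V) (hS : ∀ v ∈ S, T.parent r v ∈ S) :
    ν {f | ∀ v ∈ S, f v = a v} = T.matchingWeight r S a := by
  classical
  induction S using Finset.induction_on_max_value (T.dist r) with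
  | empty => simp [matchingWeight]
  | insert x S hx hmax ih =>
    have hS' : ∀ v ∈ S, T.parent r v ∈ S := by
      intro v hv
      by_cases hvr : v = r
      · rw [hvr, parent_self, ← hvr]; exact hv
      · refine (Finset.mem_insert.1 (hS v (Finset.mem_insert_of_mem hv))).resolve_left fun h => ?_
        have h1 := hT.dist_parent_add_one hvr
        have h2 := hmax v hv
        rw [h] at h1
        omega
    have hpS : x ≠ r → T.parent r x ∈ S := fun hxr =>
      (Finset.mem_insert.1 (hS x (Finset.mem_insert_self _ _))).resolve_left
        (hT.adj_parent hxr).ne.symm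
    rw [matchingWeight, Finset.prod_insert hx, ← matchingWeight, ← ih hS']
    have hset : {f : V → V | ∀ v ∈ insert x S, f v = a v} =
        {f | ∀ v ∈ S, f v = a v} ∩ {f | f x = a x} := by
      ext f
      simp [and_comm]
    rw [hset]
    split_ifs with hax
    · have hxr : x ≠ r := by
        rintro rfl
        rw [parent_self] at hax
        exact (ha x).1.ne hax.symm
      rw [one_mul]
      refine measure_congr ?_
      filter_upwards [hν] with f hf
      refine propext (and_iff_left_of_imp fun h => ?_)
      have h1 : f (a x) = a (a x) := h _ (hax ▸ hpS hxr)
      rw [(ha x).2] at h1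
      change f x = a x
      rw [← h1, (hf _).2, h1]
    · have hfin : (T.children r x).Finite :=
        (Set.finite_of_ncard_pos (s := T.neighborSet x) (by rw [hreg]; omega)).subset
          fun w hw => (hT.mem_children_iff.1 hw).1
      have hac : a x ∈ T.children r x := hT.mem_children_iff.2 ⟨(ha x).1, hax⟩
      have hmeas : ∀ y, MeasurableSet ({f : V → V | ∀ v ∈ S, f v = a v} ∩ {f | f x = y}) :=
        fun y => (measurableSet_agree S a).inter
          (measurable_pi_apply (X := fun _ => V) x (measurableSet_singleton y))
      have heq : ∀ c ∈ T.children r x,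
          ν ({f | ∀ v ∈ S, f v = a v} ∩ {f | f x = c}) =
            ν ({f | ∀ v ∈ S, f v = a v} ∩ {f | f x = a x}) := by
        intro c hc
        obtain ⟨g, hg1, hg2, hg3⟩ := hT.exists_iso_swap hd hreg hc hac
        have hfix : ∀ v, g v = v → g.symm v = v := fun v hv => by
          rw [RelIso.symm_apply_eq, hv]
        conv_rhs => rw [← hinv g]
        rw [Measure.map_apply _ (hmeas _)]
        · congr 1
          ext f
          simp only [Set.mem_inter_iff, Set.mem_ofPred_eq, Set.mem_preimage]
          refine and_congr (forall₂_congr fun v hv => ?_) ?_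
          · rw [hfix v (hg1 v (hmax v hv)), ← RelIso.eq_symm_apply, hfix (a v)]
            exact hg3 v _ (hmax v hv) (fun h => hx (h ▸ hv)) (ha v).1
          · rw [hfix x (hg1 x le_rfl), ← RelIso.eq_symm_apply, ← hg2, RelIso.symm_apply_apply]
        · exact measurable_pi_lambda _ fun v =>
            (Measurable.of_discrete (f := g)).comp (measurable_pi_apply _)
      have hae : ({f : V → V | ∀ v ∈ S, f v = a v} : Set (V → V)) =ᵐ[ν]
          ⋃ c ∈ hfin.toFinset, ({f : V → V | ∀ v ∈ S, f v = a v} ∩ {f | f x = c} : Set _) := by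
        filter_upwards [hν] with f hf
        refine propext ⟨fun h => ?_, fun h => ?_⟩
        · refine Set.mem_biUnion (x := f x) ?_ ⟨h, rfl⟩
          rw [Finset.mem_coe, Set.Finite.mem_toFinset, hT.mem_children_iff]
          refine ⟨(hf x).1, fun hfx => ?_⟩
          have hxr : x ≠ r := by
            rintro rfl
            rw [parent_self] at hfx
            exact (hf x).1.ne hfx.symm
          have h1 : f (f x) = a (f x) := h _ (hfx ▸ hpS hxr)
          rw [(hf x).2] at h1
          apply hax
          conv_lhs => rw [h1]
          rw [(ha _).2, hfx]
        · obtain ⟨c, -, h'⟩ := Set.mem_iUnion₂.1 h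
          exact h'.1
      rw [measure_congr hae, measure_biUnion_finset _ fun c _ => hmeas c,
        Finset.sum_congr rfl fun c hc => heq c (hfin.mem_toFinset.1 hc), Finset.sum_const,
        ← Set.ncard_eq_toFinset_card _ hfin, nsmul_eq_mul, ← mul_assoc,
        ENNReal.inv_mul_cancel, one_mul]
      · exact_mod_cast ((Set.ncard_pos hfin).2 ⟨_, hac⟩).ne'
      · exact ENNReal.natCast_ne_top _
      · intro c _ c' _ hcc
        refine Set.disjoint_left.2 fun f h h' => hcc ?_
        rw [← h.2, ← h'.2]

/-- There is a measure on partner functions with the given weights. -/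
lemma IsTree.exists_measure_agree (hT : T.IsTree) (hd : 2 ≤ d)
    (hreg : ∀ v : V, (T.neighborSet v).ncard = d) (r : V) :
    ∃ ν : Measure (V → V), IsProbabilityMeasure ν ∧ (∀ᵐ f ∂ν, T.IsPartner f) ∧
      ∀ a, T.IsPartner a → ∀ S : Finset V, (∀ v ∈ S, T.parent r v ∈ S) →
        ν {f | ∀ v ∈ S, f v = a v} = T.matchingWeight r S a := by
  classical
  have hpos : ∀ v, 0 < (T.children r v).ncard := fun v => by
    by_cases hv : v = r
    · subst hv; rw [hT.children_root, hreg]; omega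
    · rw [hT.ncard_children hreg hv]; omega
  have _ : ∀ v, Finite (T.children r v) := fun v => Set.finite_of_ncard_pos (hpos v)
  let _ : ∀ v, Fintype (T.children r v) := fun v => Fintype.ofFinite _
  have _ : ∀ v, Nonempty (T.children r v) := fun v =>
    (Set.nonempty_of_ncard_ne_zero (hpos v).ne').to_subtype
  let P : ∀ v, Measure (T.children r v) := fun v => (PMF.uniformOfFintype _).toMeasure
  choose F hF0 hF using fun c : ∀ v, T.children r v =>
    hT.exists_rec r (c r : V) fun v y => if y = v then T.parent r v else c v
  have hmeas : Measurable F := by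
    refine measurable_pi_lambda _ (hT.parent_induction r ?_ fun v hv ih => ?_)
    · simp only [hF0]
      exact measurable_subtype_coe.comp (measurable_pi_apply r)
    · simp only [fun c => hF c v hv]
      exact Measurable.ite (ih (measurableSet_singleton v)) measurable_const
        (measurable_subtype_coe.comp (measurable_pi_apply v))
  have hpartner : ∀ c, T.IsPartner (F c) := by
    intro c
    have hcase : ∀ v, F c v = c v ∨ (v ≠ r ∧ F c (T.parent r v) = v ∧ F c v = T.parent r v) := by
      intro v
      by_cases hv : v = r
      · subst hv; exact .inl (hF0 c)
      · rw [hF c v hv]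
        split_ifs with h
        · exact .inr ⟨hv, h, rfl⟩
        · exact .inl rfl
    intro v
    rcases hcase v with h | ⟨hv, h, h'⟩
    · have hc := (c v).2
      rw [← h] at hc
      refine ⟨(hT.mem_children_iff.1 hc).1, ?_⟩
      rw [hF c _ hc.1, hc.2, if_pos rfl]
    · exact ⟨h' ▸ hT.adj_parent hv, by rw [h', h]⟩
  refine ⟨(Measure.infinitePi P).map F, Measure.isProbabilityMeasure_map hmeas.aemeasurable,
    ?_, fun a ha S hS => ?_⟩
  · rw [ae_map_iff hmeas.aemeasurable (measurableSet_isPartner T)]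
    exact .of_forall hpartner
  · rw [Measure.map_apply hmeas (measurableSet_agree S a)]
    let t : ∀ v, Set (T.children r v) := fun v =>
      if a v = T.parent r v then Set.univ else {y | (y : V) = a v}
    have hpre : F ⁻¹' {f | ∀ v ∈ S, f v = a v} = Set.pi S t := by
      ext c
      simp only [Set.mem_preimage, Set.mem_ofPred_eq, Set.mem_pi, Finset.mem_coe]
      constructor
      · intro h v hv
        by_cases hav : a v = T.parent r v
        · simp [t, hav]
        · simp only [t, hav, if_false, Set.mem_ofPred_eq]
          rw [← h v hv] at hav ⊢
          by_cases hvr : v = r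
          · subst hvr; rw [hF0]
          · rw [hF c v hvr] at hav ⊢
            rw [if_neg]
            intro h'
            simp [h'] at hav
      · intro h
        refine hT.parent_induction r (fun hr => ?_) fun v hvr ih hv => ?_
        · have har : a r ≠ T.parent r r := by
            rw [parent_self]
            exact (ha r).1.ne.symm
          have := h r hr
          simp only [t, har, if_false, Set.mem_ofPred_eq] at this
          rw [hF0, this]
        · rw [hF c v hvr, ih (hS v hv)]
          have hiff : a (T.parent r v) = v ↔ a v = T.parent r v :=
            ⟨fun h => by rw [← (ha (T.parent r v)).2, h], fun h => by rw [← h, (ha v).2]⟩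
          have := h v hv
          by_cases hav : a v = T.parent r v
          · rw [if_pos (hiff.2 hav), hav]
          · rw [if_neg (mt hiff.1 hav)]
            simpa [t, hav] using this
    rw [hpre, Measure.infinitePi_pi P fun _ _ => MeasurableSet.of_discrete, matchingWeight]
    refine Finset.prod_congr rfl fun v _ => ?_
    split_ifs with hav
    · simp [t, hav]
    · have hmem : a v ∈ T.children r v := hT.mem_children_iff.2 ⟨(ha v).1, hav⟩
      have ht : t v = {⟨a v, hmem⟩} := by
        ext y
        simp [t, hav, Subtype.ext_iff]
      rw [ht, PMF.toMeasure_apply_singleton _ _ (measurableSet_singleton _),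
        PMF.uniformOfFintype_apply, ← Nat.card_eq_fintype_card, Nat.card_coe_set_eq]

end Measure

lemma IsTree.dist_iso (hT : T.IsTree) (g : T ≃g T) (v w : V) : T.dist (g v) (g w) = T.dist v w := by
  have key : ∀ (g : T ≃g T) v w, T.dist (g v) (g w) ≤ T.dist v w := by
    intro g v w
    obtain ⟨p, hp⟩ := hT.connected.exists_walk_length_eq_dist v w
    rw [← hp, ← Walk.length_map g.toHom p]
    exact dist_le _
  refine (key g v w).antisymm ?_
  simpa using key g.symm (g v) (g w)

/-- Sublevel sets of the sum of the distances to `r` and `q` are closed under taking parents. -/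
lemma IsTree.dist_parent_add_dist_le (hT : T.IsTree) {q v : V} {n : ℕ}
    (h : T.dist r v + T.dist q v ≤ n) :
    T.dist r (T.parent r v) + T.dist q (T.parent r v) ≤ n := by
  by_cases hv : v = r
  · subst hv
    rwa [parent_self]
  · have h1 := hT.dist_parent_add_one hv
    have h2 := hT.dist_eq_dist_add_one_of_adj q (hT.adj_parent hv)
    omega

lemma IsPartner.conj {a : V → V} (ha : T.IsPartner a) (g : T ≃g T) :
    T.IsPartner fun v => g (a (g.symm v)) := fun v => by
  refine ⟨?_, by simp [(ha _).2]⟩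
  rw [← g.symm.map_adj_iff]
  simpa using (ha (g.symm v)).1

section Measure

variable [MeasurableSpace V] [DiscreteMeasurableSpace V]

lemma measurable_conj (g : T ≃g T) : Measurable fun (f : V → V) v => g (f (g.symm v)) :=
  measurable_pi_lambda _ fun _ => (Measurable.of_discrete (f := g)).comp (measurable_pi_apply _)

lemma IsTree.map_conj_of_measure_agree [Countable V] (hT : T.IsTree) (hd : d ≠ 0)
    (hreg : ∀ v : V, (T.neighborSet v).ncard = d) {ν : Measure (V → V)} [IsProbabilityMeasure ν]
    (hν : ∀ᵐ f ∂ν, T.IsPartner f)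
    (hagree : ∀ a, T.IsPartner a → ∀ S : Finset V, (∀ v ∈ S, T.parent r v ∈ S) →
        ν {f | ∀ v ∈ S, f v = a v} = T.matchingWeight r S a) (g : T ≃g T) :
    ν.map (fun f v => g (f (g.symm v))) = ν := by
  classical
  have := Measure.isProbabilityMeasure_map (μ := ν) (measurable_conj g).aemeasurable
  refine IsPartner.measure_ext (T := T) ?_ hν fun I => ?_
  · rw [ae_map_iff (measurable_conj g).aemeasurable (measurableSet_isPartner T)]
    filter_upwards [hν] with f hf using hf.conj g
  let N := T.dist r (g r) + I.sup fun v => T.dist r v + T.dist (g r) v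
  have hfin : {v | T.dist r v + T.dist (g r) v ≤ N}.Finite :=
    (hT.finite_dist_le (fun v => Set.finite_of_ncard_pos (by rw [hreg]; omega)) r N).subset
      fun v hv => le_trans (Nat.le_add_right _ _) hv
  let S := hfin.toFinset
  have hmem : ∀ v, v ∈ S ↔ T.dist r v + T.dist (g r) v ≤ N := by simp [S]
  let S' := S.map g.symm.toEquiv.toEmbedding
  have hmem' : ∀ v, v ∈ S' ↔ g v ∈ S := fun v => Finset.mem_map_equiv
  have hdist : ∀ v, g v ∈ S ↔ T.dist r v + T.dist (g.symm r) v ≤ N := fun v => by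
    rw [hmem, hT.dist_iso, ← hT.dist_iso g (g.symm r) v, RelIso.apply_symm_apply, add_comm]
  refine ⟨S, fun v hv => ?_, fun a ha => ?_⟩
  · rw [hmem]
    have := Finset.le_sup (f := fun v => T.dist r v + T.dist (g r) v) hv
    simp only [N]
    omega
  have ha' := ha.conj g.symm
  have hr : r ∈ S := by
    rw [hmem, dist_self, zero_add, dist_comm]
    exact Nat.le_add_right _ _
  have hr' : r ∈ S' := by
    rw [hmem', hmem, dist_self, add_zero]
    exact Nat.le_add_right _ _
  have hclosed : ∀ v ∈ S, T.parent r v ∈ S := fun v hv => by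
    rw [hmem] at hv ⊢
    exact hT.dist_parent_add_dist_le hv
  have hclosed' : ∀ v ∈ S', T.parent r v ∈ S' := fun v hv => by
    rw [hmem', hdist] at hv ⊢
    exact hT.dist_parent_add_dist_le hv
  rw [Measure.map_apply (measurable_conj g) (measurableSet_agree S a)]
  have hpre : (fun (f : V → V) v => g (f (g.symm v))) ⁻¹' {f | ∀ v ∈ S, f v = a v} =
      {f | ∀ v ∈ S', f v = g.symm (a (g.symm.symm v))} := by
    ext f
    simp only [Set.mem_preimage, Set.mem_ofPred_eq, S', Finset.forall_mem_map]
    refine forall₂_congr fun v _ => ?_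
    rw [← RelIso.eq_symm_apply]
    simp
  rw [hpre, hagree _ ha' S' hclosed', hagree a ha S hclosed,
    hT.matchingWeight_eq hreg hr hclosed ha, hT.matchingWeight_eq hreg hr' hclosed' ha',
    Finset.card_map, Finset.filter_map, Finset.card_map]
  congr 6
  ext v
  simp [hmem']

end Measure

/-- The edge set of a matching given by its partner function. -/
noncomputable def partnerEdges (T : SimpleGraph V) (f : V → V) : T.edgeSet → Bool :=
  open Classical in fun e => decide (∃ v, s(v, f v) = (e : Sym2 V))

open Classical in
/-- A neighbour of `v` along an edge of `ω`. -/
noncomputable def partner (ω : T.edgeSet → Bool) (v : V) : V :=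
  if h : ∃ w : T.neighborSet v, ω ⟨s(v, w), w.2⟩ = true then h.choose else v

/-- `ω` is the indicator function of a perfect matching. -/
def IsMatchingIndicator (ω : T.edgeSet → Bool) : Prop :=
  ∀ v : V, ∃! e : T.edgeSet, v ∈ (e : Sym2 V) ∧ ω e = true

lemma partnerEdges_eq_true_iff {f : V → V} {e : T.edgeSet} :
    T.partnerEdges f e = true ↔ ∃ v, s(v, f v) = (e : Sym2 V) := by
  simp [partnerEdges]

lemma IsPartner.isMatchingIndicator {f : V → V} (hf : T.IsPartner f) :
    IsMatchingIndicator (T.partnerEdges f) := by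
  intro v
  refine ⟨⟨s(v, f v), (hf v).1⟩, ⟨Sym2.mem_mk_left _ _, partnerEdges_eq_true_iff.2 ⟨v, rfl⟩⟩, ?_⟩
  rintro ⟨e, he⟩ ⟨hv, h⟩
  obtain ⟨u, rfl⟩ := partnerEdges_eq_true_iff.1 h
  apply Subtype.ext
  change s(u, f u) = s(v, f v)
  rcases Sym2.mem_iff.1 hv with rfl | rfl
  · rfl
  · rw [(hf u).2, Sym2.eq_swap]

lemma adj_partner {ω : T.edgeSet → Bool} {v w : V} (h : T.Adj v w) (hw : ω ⟨s(v, w), h⟩ = true) :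
    ∃ h' : T.Adj v (partner ω v), ω ⟨s(v, partner ω v), h'⟩ = true := by
  have hex : ∃ w : T.neighborSet v, ω ⟨s(v, w), w.2⟩ = true := ⟨⟨w, h⟩, hw⟩
  rw [partner, dif_pos hex]
  exact ⟨hex.choose.2, hex.choose_spec⟩

namespace IsMatchingIndicator

variable {ω : T.edgeSet → Bool}

lemma exists_adj_partner (hω : IsMatchingIndicator ω) (v : V) :
    ∃ h : T.Adj v (partner ω v), ω ⟨s(v, partner ω v), h⟩ = true := by
  obtain ⟨⟨e, he⟩, ⟨hv, h⟩, -⟩ := hω v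
  obtain ⟨w, rfl⟩ := Sym2.mem_iff_exists.1 hv
  exact adj_partner he h

lemma partner_eq (hω : IsMatchingIndicator ω) {v w : V} (h : T.Adj v w)
    (hw : ω ⟨s(v, w), h⟩ = true) : partner ω v = w := by
  obtain ⟨h', hp⟩ := hω.exists_adj_partner v
  have := (hω v).unique ⟨Sym2.mem_mk_left _ _, hp⟩ ⟨Sym2.mem_mk_left _ _, hw⟩
  exact Sym2.congr_right.1 (congrArg Subtype.val this)

lemma isPartner (hω : IsMatchingIndicator ω) : T.IsPartner (partner ω) := by
  intro v
  obtain ⟨h, hp⟩ := hω.exists_adj_partner v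
  refine ⟨h, hω.partner_eq h.symm ?_⟩
  rw [← hp]
  congr 2
  exact Sym2.eq_swap

lemma partnerEdges_partner (hω : IsMatchingIndicator ω) : T.partnerEdges (partner ω) = ω := by
  ext ⟨e, he⟩
  rw [Bool.eq_iff_iff, partnerEdges_eq_true_iff]
  constructor
  · rintro ⟨v, rfl⟩
    exact (hω.exists_adj_partner v).2
  · intro h
    induction e using Sym2.ind with
    | _ v w => exact ⟨v, by rw [hω.partner_eq he h]⟩

lemma partner_comp_iso (hω : IsMatchingIndicator ω) (g : T ≃g T) (v : V) :
    partner (fun e => ω (g.symm.mapEdgeSet e)) v = g (partner ω (g.symm v)) := by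
  obtain ⟨h, hp⟩ := hω.exists_adj_partner (g.symm v)
  have hadj : T.Adj v (g (partner ω (g.symm v))) := by
    rw [← g.symm.map_adj_iff]
    simpa using h
  obtain ⟨h', hp'⟩ := adj_partner (ω := fun e => ω (g.symm.mapEdgeSet e)) hadj (by
    rw [← hp]
    congr 2
    simp [Hom.mapEdgeSet])
  rw [← RelIso.symm_apply_eq]
  exact (hω.partner_eq (g.symm.map_adj_iff.2 h') hp').symm

end IsMatchingIndicator

lemma partnerEdges_conj (f : V → V) (g : T ≃g T) :
    T.partnerEdges (fun v => g (f (g.symm v))) =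
      fun e => T.partnerEdges f (g.symm.mapEdgeSet e) := by
  ext ⟨e, he⟩
  rw [Bool.eq_iff_iff, partnerEdges_eq_true_iff, partnerEdges_eq_true_iff]
  change _ ↔ ∃ v, s(v, f v) = e.map g.symm
  constructor
  · rintro ⟨v, rfl⟩
    exact ⟨g.symm v, by simp⟩
  · rintro ⟨v, hv⟩
    refine ⟨g v, ?_⟩
    apply Sym2.map.injective g.symm.injective
    rw [← hv]
    simp

section Measure

variable [Countable V]

lemma measurable_partnerEdges [MeasurableSpace V] [DiscreteMeasurableSpace V] : Measurable T.partnerEdges := by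
  refine measurable_pi_lambda _ fun e => measurable_to_bool ?_
  have : (fun f => T.partnerEdges f e) ⁻¹' {true} =
      ⋃ v, (fun f : V → V => f v) ⁻¹' {w | s(v, w) = (e : Sym2 V)} := by
    ext f
    simp [partnerEdges_eq_true_iff]
  rw [this]
  exact .iUnion fun v => measurable_pi_apply v .of_discrete

lemma measurable_partner [MeasurableSpace V] (hfin : ∀ v, (T.neighborSet v).Finite) :
    Measurable (partner : (T.edgeSet → Bool) → V → V) := by
  classical
  refine measurable_pi_lambda _ fun v => ?_
  have := (hfin v).to_subtype
  let F : (T.neighborSet v → Bool) → V := fun b => if h : ∃ w, b w = true then h.choose else v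
  have hm : Measurable fun (ω : T.edgeSet → Bool) (w : T.neighborSet v) => ω ⟨s(v, w), w.2⟩ :=
    measurable_pi_lambda _ fun _ => measurable_pi_apply _
  exact (Measurable.of_discrete (f := F)).comp hm

lemma measurableSet_isMatchingIndicator :
    MeasurableSet {ω : T.edgeSet → Bool | IsMatchingIndicator ω} := by
  have : {ω : T.edgeSet → Bool | IsMatchingIndicator ω} =
      ⋂ v : V, ⋃ e : T.edgeSet, ({ω | v ∈ (e : Sym2 V) ∧ ω e = true} ∩
        ⋂ e' : T.edgeSet, {ω | v ∈ (e' : Sym2 V) ∧ ω e' = true → e' = e}) := by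
    ext ω
    simp [IsMatchingIndicator, ExistsUnique]
  have hm : ∀ (e : T.edgeSet) (s : Set Bool), MeasurableSet {ω : T.edgeSet → Bool | ω e ∈ s} :=
    fun e s => measurable_pi_apply (X := fun _ => Bool) e .of_discrete
  have _ : Countable (Sym2 V) := Quot.mk_surjective.countable
  rw [this]
  refine .iInter fun v => .iUnion fun e => .inter ?_ (.iInter fun e' => ?_)
  · exact hm e {b | v ∈ (e : Sym2 V) ∧ b = true}
  · exact hm e' {b | v ∈ (e' : Sym2 V) ∧ b = true → e' = e}

end Measure

end SimpleGraph

/-- On the `d`-regular tree (`d ≥ 3`), there is exactly one probability measure on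
`{0,1}^{E(T)}` (product σ-algebra, with `{0,1}` identified with `Bool`) that is
concentrated on indicator functions of perfect matchings and is invariant under the
action `(g · ω)(e) = ω (g⁻¹ e)` of every graph automorphism `g` of `T`. -/
theorem existsUnique_invariant_perfectMatching_measure {V : Type} [Nonempty V]
    (d : ℕ) (hd : 3 ≤ d) (T : SimpleGraph V)
    (hconn : T.Connected) (hacyc : T.IsAcyclic)
    (hreg : ∀ v : V, (T.neighborSet v).ncard = d) :
    ∃! μ : Measure (T.edgeSet → Bool),
      IsProbabilityMeasure μ ∧
      μ {ω : T.edgeSet → Bool |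
          ∀ v : V, ∃! e : T.edgeSet, v ∈ (e : Sym2 V) ∧ ω e = true} = 1 ∧
      ∀ g : T ≃g T,
        μ.map (fun ω : T.edgeSet → Bool => fun e : T.edgeSet =>
          ω (SimpleGraph.Iso.mapEdgeSet g.symm e)) = μ := by
  open SimpleGraph in
  classical
  let _ : MeasurableSpace V := ⊤
  have hT : T.IsTree := ⟨hconn, hacyc⟩
  have hd0 : d ≠ 0 := by omega
  have hfin : ∀ v, (T.neighborSet v).Finite := fun v =>
    Set.finite_of_ncard_pos (by rw [hreg]; omega)
  have _ : Countable V := hT.countable_of_finite_neighborSet hfin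
  obtain ⟨r⟩ := ‹Nonempty V›
  change ∃! μ : Measure (T.edgeSet → Bool), IsProbabilityMeasure μ ∧
    μ {ω | IsMatchingIndicator ω} = 1 ∧ _
  have hact : ∀ g : T ≃g T, Measurable fun (ω : T.edgeSet → Bool) (e : T.edgeSet) =>
      ω (SimpleGraph.Iso.mapEdgeSet g.symm e) := fun g =>
    measurable_pi_lambda _ fun e => measurable_pi_apply _
  obtain ⟨ν, hν, hνp, hνa⟩ := hT.exists_measure_agree (by omega) hreg r
  have hpart := measurable_partner hfin
  refine ⟨ν.map T.partnerEdges,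
    ⟨Measure.isProbabilityMeasure_map measurable_partnerEdges.aemeasurable, ?_, fun g => ?_⟩, ?_⟩
  · have := Measure.isProbabilityMeasure_map (μ := ν) (measurable_partnerEdges (T := T)).aemeasurable
    rw [← mem_ae_iff_prob_eq_one measurableSet_isMatchingIndicator]
    change ∀ᵐ ω ∂_, _
    rw [ae_map_iff measurable_partnerEdges.aemeasurable measurableSet_isMatchingIndicator]
    filter_upwards [hνp] with f hf using hf.isMatchingIndicator
  · rw [Measure.map_map (hact g) measurable_partnerEdges]
    conv_rhs => rw [← hT.map_conj_of_measure_agree hd0 hreg hνp hνa g,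
      Measure.map_map measurable_partnerEdges (measurable_conj g)]
    congr 1
    ext1 f
    exact (partnerEdges_conj f g).symm
  · rintro μ ⟨hμ, hμ1, hμg⟩
    have hμm : ∀ᵐ ω ∂μ, IsMatchingIndicator ω :=
      (mem_ae_iff_prob_eq_one measurableSet_isMatchingIndicator).2 hμ1
    have hprob := Measure.isProbabilityMeasure_map (μ := μ) hpart.aemeasurable
    have hp : ∀ᵐ f ∂μ.map partner, T.IsPartner f := by
      rw [ae_map_iff hpart.aemeasurable (measurableSet_isPartner T)]
      filter_upwards [hμm] with ω hω using hω.isPartner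
    have hinv : ∀ g : T ≃g T, (μ.map partner).map (fun f v => g (f (g.symm v))) =
        μ.map partner := by
      intro g
      rw [Measure.map_map (measurable_conj g) hpart]
      conv_rhs => rw [← hμg g, Measure.map_map hpart (hact g)]
      refine Measure.map_congr ?_
      filter_upwards [hμm] with ω hω
      ext1 v
      exact (hω.partner_comp_iso g v).symm
    have heq : μ.map partner = ν := by
      refine IsPartner.measure_ext hp hνp fun I => ?_
      let N := I.sup (T.dist r)
      refine ⟨(hT.finite_dist_le hfin r N).toFinset, fun v hv => ?_, fun a ha => ?_⟩
      · simpa using Finset.le_sup (f := T.dist r) hv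
      · have hclosed : ∀ v ∈ (hT.finite_dist_le hfin r N).toFinset,
            T.parent r v ∈ (hT.finite_dist_le hfin r N).toFinset := by
          intro v hv
          by_cases hvr : v = r
          · have hpv : T.parent r v = v := by rw [hvr, parent_self]
            rwa [hpv]
          · have := hT.dist_parent_add_one hvr
            simp only [Set.Finite.mem_toFinset, Set.mem_ofPred_eq] at hv ⊢
            omega
        rw [hT.measure_agree_of_invariant hd0 hreg hp hinv ha _ hclosed, hνa a ha _ hclosed]
    rw [← heq, Measure.map_map measurable_partnerEdges hpart]
    conv_lhs => rw [← Measure.map_id (μ := μ)]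
    refine Measure.map_congr ?_
    filter_upwards [hμm] with ω hω using hω.partnerEdges_partner.symm
end

section
/- Let d ≥ 3 and n ≥ 2 be natural numbers, and let G be a simple graph on a finite vertex set V such that every vertex has degree at most d and the girth of G is at least 2n+1. Then there exists a probability measure μ on the space of functions V → {0,1} (with all subsets measurable) such that for every edge {u,v} of G, μ({f : f(u) ≠ f(v)}) ≥ (1/π)·arccos( −(2√(d−1)/d) / (1 + (d−1)/(d·(n−1))) ). -/
open MeasureTheory Real

namespace SimpleGraph

variable {V : Type*} {G : SimpleGraph V} {n : ℕ} {u v w x y : V}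

open Classical in
/-- The distance from `u` to `w`, set to `n` if `w` is not reachable from `u`. -/
noncomputable def distOr (G : SimpleGraph V) (n : ℕ) (u w : V) : ℕ :=
  if G.Reachable u w then G.dist u w else n

theorem distOr_comm (u w : V) : G.distOr n u w = G.distOr n w u := by
  classical
  rw [distOr, distOr, dist_comm]
  exact if_congr reachable_comm rfl rfl

theorem distOr_self (u : V) : G.distOr n u u = 0 := by
  simp [distOr]

theorem distOr_eq_iff {k : ℕ} (hk : k < n) :
    G.distOr n u w = k ↔ G.Reachable u w ∧ G.dist u w = k := by
  unfold distOr
  split_ifs with h <;> simp [h]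
  omega

theorem distOr_eq_zero_iff (hn : 0 < n) : G.distOr n u w = 0 ↔ u = w := by
  rw [distOr_eq_iff hn]
  refine ⟨fun h => h.1.dist_eq_zero_iff.1 h.2, ?_⟩
  rintro rfl
  simp

theorem Adj.distOr_le (h : G.Adj w x) (u : V) : G.distOr n u x ≤ G.distOr n u w + 1 := by
  have hiff : G.Reachable u w ↔ G.Reachable u x :=
    ⟨fun hr => hr.trans h.reachable, fun hr => hr.trans h.symm.reachable⟩
  unfold distOr
  rw [hiff]
  split_ifs
  · have := h.reachable.dist_triangle_right u
    rwa [dist_eq_one_iff_adj.2 h] at this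
  · omega

theorem exists_adj_distOr {k : ℕ} (hk : k + 1 < n) (h : G.distOr n u w = k + 1) :
    ∃ x, G.Adj w x ∧ G.distOr n u x = k := by
  obtain ⟨hr, hd⟩ := (distOr_eq_iff hk).1 h
  obtain ⟨p, hp⟩ := hr.symm.exists_walk_length_eq_dist
  rw [dist_comm, hd] at hp
  cases p with
  | nil => simp at hp
  | @cons _ x _ hx q =>
    refine ⟨x, hx, (distOr_eq_iff (by omega)).2 ⟨q.reachable.symm, ?_⟩⟩
    have h₁ := dist_le q
    have h₂ := hx.symm.reachable.dist_triangle_right u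
    rw [dist_eq_one_iff_adj.2 hx.symm] at h₂
    rw [dist_comm] at h₁
    simp at hp
    omega

theorem eq_of_adj_of_distOr_le (hg : (2 * n + 1 : ℕ∞) ≤ G.egirth) (hw : G.distOr n u w < n)
    (hx : G.Adj w x) (hxw : G.distOr n u x ≤ G.distOr n u w)
    (hy : G.Adj w y) (hyw : G.distOr n u y ≤ G.distOr n u w) : x = y := by
  have key : ∀ z, G.Adj w z → G.distOr n u z ≤ G.distOr n u w →
      ∃ (p : G.Walk u z) (hz : G.Adj z w), (p.concat hz).IsPath ∧ (p.concat hz).length ≤ n := by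
    intro z hz hzw
    obtain ⟨hr, hd⟩ := (distOr_eq_iff (hzw.trans_lt hw)).1 rfl
    obtain ⟨hrw, hdw⟩ := (distOr_eq_iff hw).1 rfl
    obtain ⟨p, hp, hl⟩ := hr.exists_path_of_dist
    refine ⟨p, hz.symm, hp.concat (fun hmem => ?_) _, ?_⟩
    · classical
      have h₁ := p.length_takeUntil_lt_length hmem hz.ne
      have h₂ := dist_le (p.takeUntil w hmem)
      omega
    · rw [Walk.length_concat]
      omega
  obtain ⟨p, hpw, hp, hpl⟩ := key x hx hxw
  obtain ⟨q, hqw, hq, hql⟩ := key y hy hyw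
  by_contra hne
  have hpq : p.concat hpw ≠ q.concat hqw := fun h => hne (Walk.concat_inj h).1
  obtain ⟨z, -, -, c, hc, hcl⟩ := hp.exists_isCycle_length_le_add_of_ne hq hpq
  have h₁ : ((2 * n + 1 : ℕ) : ℕ∞) ≤ c.length := by
    push_cast
    exact hg.trans (egirth_le_length hc)
  have h₂ : 2 * n + 1 ≤ c.length := by exact_mod_cast h₁
  omega

theorem Adj.distOr_eq (hg : (2 * n + 1 : ℕ∞) ≤ G.egirth) (h : G.Adj u v)
    (hw : G.distOr n u w < n) :
    G.distOr n v w = G.distOr n u w + 1 ∨ G.distOr n u w = G.distOr n v w + 1 := by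
  rw [distOr_comm u w] at *
  rw [distOr_comm v w]
  have h₁ := h.distOr_le (n := n) w
  have h₂ := h.symm.distOr_le (n := n) w
  by_contra! hne
  have heq : G.distOr n w v = G.distOr n w u := by omega
  rcases hk : G.distOr n w u with _ | k
  · rw [hk] at heq
    rw [distOr_eq_zero_iff (by omega)] at hk heq
    exact h.ne (hk.symm.trans heq)
  · obtain ⟨x, hx, hxk⟩ := exists_adj_distOr (hk ▸ hw) hk
    have := eq_of_adj_of_distOr_le hg hw hx (by omega) h heq.le
    subst this
    omega

open Classical in
/-- Double counting of the edges between the spheres of radius `k` and `k + 1`. -/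
theorem card_sphere_succ [Fintype V] (hg : (2 * n + 1 : ℕ∞) ≤ G.egirth) {k : ℕ} (hk : k + 1 < n)
    (u : V) :
    ∑ w, (if G.distOr n u w = k + 1 then (1 : ℝ) else 0) =
      ∑ w, (if G.distOr n u w = k then ((G.neighborSet w).ncard - 1 : ℝ) else 0) +
        if k = 0 then 1 else 0 := by
  have hup : ∀ w, (if G.distOr n u w = k + 1 then (1 : ℝ) else 0) =
      ∑ x, if G.Adj w x ∧ G.distOr n u w = k + 1 ∧ G.distOr n u x = k then (1 : ℝ) else 0 := by
    intro w
    split_ifs with hw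
    · obtain ⟨x, hx, hxk⟩ := exists_adj_distOr hk hw
      rw [Finset.sum_eq_single x]
      · simp [hx, hxk, hw]
      · intro y _ hyx
        rw [if_neg]
        rintro ⟨hy, -, hyk⟩
        exact hyx (eq_of_adj_of_distOr_le (u := u) hg (by omega) hy (by omega) hx (by omega))
      · simp
    · simp [hw]
  have hdown : ∀ x,
      (∑ w, if G.Adj w x ∧ G.distOr n u w = k + 1 ∧ G.distOr n u x = k then (1 : ℝ) else 0) =
      (if G.distOr n u x = k then ((G.neighborSet x).ncard - 1 : ℝ) else 0) +
        if k = 0 ∧ u = x then 1 else 0 := by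
    intro x
    have hdeg : ((G.neighborSet x).ncard : ℝ) = ∑ w, if G.Adj x w then (1 : ℝ) else 0 := by
      rw [Set.ncard_eq_toFinset_card']
      simp [← SimpleGraph.neighborFinset_eq_filter]
    split_ifs with hx h0 h0
    · obtain ⟨rfl, rfl⟩ := h0
      rw [hdeg, sub_add_cancel]
      refine Finset.sum_congr rfl fun w _ => ?_
      have hiff : G.Adj u w → G.distOr n u w = 1 := by
        intro h
        have := h.distOr_le (n := n) u
        rw [hx] at this
        have h0 : G.distOr n u w ≠ 0 := fun h0 =>
          h.ne ((distOr_eq_zero_iff (by omega)).1 h0)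
        omega
      simp only [hx, and_true, G.adj_comm w u]
      congr 1
      simp only [zero_add, eq_iff_iff, and_iff_left_iff_imp]
      exact hiff
    · obtain ⟨k, rfl⟩ : ∃ l, k = l + 1 := by
        rcases k with _ | l
        · exact absurd ⟨rfl, (distOr_eq_zero_iff (by omega)).1 hx⟩ h0
        · exact ⟨l, rfl⟩
      obtain ⟨y, hy, hyk⟩ := exists_adj_distOr (by omega) hx
      have : ∀ w, (if G.Adj w x ∧ G.distOr n u w = k + 1 + 1 ∧ G.distOr n u x = k + 1
          then (1 : ℝ) else 0) = (if G.Adj x w then 1 else 0) - if w = y then 1 else 0 := by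
        intro w
        by_cases hw : G.Adj x w
        · by_cases hwy : w = y
          · subst hwy
            simp [hw, hyk, show k ≠ k + 1 + 1 by omega]
          · have h₁ := hw.distOr_le (n := n) u
            have h₂ : ¬ G.distOr n u w ≤ k + 1 := fun h => hwy <|
              eq_of_adj_of_distOr_le (u := u) hg (by omega) hw (by omega) hy (by omega)
            have h₃ : G.distOr n u w = k + 1 + 1 := by omega
            simp [hw, hw.symm, hwy, h₃, hx]
        · have hwy : w ≠ y := fun h => hw (h ▸ hy)
          simp [hw, hwy, G.adj_comm w x]
      rw [Finset.sum_congr rfl fun w _ => this w, Finset.sum_sub_distrib, hdeg]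
      simp
    · exact absurd (h0.1 ▸ h0.2 ▸ distOr_self u) hx
    · simp [hx]
  rw [Finset.sum_congr rfl fun w _ => hup w, Finset.sum_comm,
    Finset.sum_congr rfl fun x _ => hdown x, Finset.sum_add_distrib]
  congr 1
  split_ifs with h <;> simp [h]

end SimpleGraph

section HalfSpaces

variable {E : Type*} [NormedAddCommGroup E] [InnerProductSpace ℝ E]

/-- The set of vectors separated from each other by the hyperplane orthogonal to `z`. -/
def separators (x y : E) : Set E := {z | ¬(0 ≤ inner ℝ x z ↔ 0 ≤ inner ℝ y z)}

/-- The point at angle `t` on the circle spanned by the orthonormal pair `e₁`, `e₂`. -/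
noncomputable def circlePoint (e₁ e₂ : E) (t : ℝ) : E := cos t • e₁ + sin t • e₂

theorem separators_comm (x y : E) : separators x y = separators y x := by
  ext z
  simp only [separators, Set.mem_ofPred_eq]
  tauto

theorem separators_subset_union (x y w : E) :
    separators x w ⊆ separators x y ∪ separators y w := by
  intro z
  simp only [separators, Set.mem_ofPred_eq, Set.mem_union]
  tauto

theorem separators_smul_left {r : ℝ} (hr : 0 < r) (x y : E) :
    separators (r • x) y = separators x y := by
  ext z
  simp [separators, inner_smul_left, mul_nonneg_iff_of_pos_left hr]

theorem inner_circlePoint_left (e₁ e₂ z : E) (t : ℝ) :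
    inner ℝ (circlePoint e₁ e₂ t) z = cos t * inner ℝ e₁ z + sin t * inner ℝ e₂ z := by
  simp [circlePoint, inner_add_left, inner_smul_left]

theorem sin_mul_inner_circlePoint (e₁ e₂ z : E) (a b : ℝ) :
    sin (a + b) * inner ℝ (circlePoint e₁ e₂ a) z =
      sin b * inner ℝ (circlePoint e₁ e₂ 0) z +
        sin a * inner ℝ (circlePoint e₁ e₂ (a + b)) z := by
  simp only [inner_circlePoint_left, cos_zero, sin_zero, sin_add, cos_add]
  linear_combination (sin b * inner ℝ e₁ z) * sin_sq_add_cos_sq a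

section Disjoint

variable {e₁ e₂ : E} {a b : ℝ}

theorem disjoint_separators_circlePoint (ha : 0 < a) (hb : 0 < b) (hab : a + b < π) :
    Disjoint (separators (circlePoint e₁ e₂ 0) (circlePoint e₁ e₂ a))
      (separators (circlePoint e₁ e₂ a) (circlePoint e₁ e₂ (a + b))) := by
  rw [Set.disjoint_left]
  intro z
  have h := sin_mul_inner_circlePoint e₁ e₂ z a b
  have hsa := sin_pos_of_pos_of_lt_pi ha (by linarith)
  have hsb := sin_pos_of_pos_of_lt_pi hb (by linarith)
  have hsab := sin_pos_of_pos_of_lt_pi (add_pos ha hb) hab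
  simp only [separators, Set.mem_ofPred_eq]
  generalize inner ℝ (circlePoint e₁ e₂ 0) z = p at *
  generalize inner ℝ (circlePoint e₁ e₂ a) z = q at *
  generalize inner ℝ (circlePoint e₁ e₂ (a + b)) z = r at *
  intro h₁ h₂
  rcases le_or_gt 0 q with hq | hq
  · have hp : p < 0 := by
      by_contra! hp
      exact h₁ ⟨fun _ => hq, fun _ => hp⟩
    have hr : r < 0 := by
      by_contra! hr
      exact h₂ ⟨fun _ => hr, fun _ => hq⟩
    nlinarith [mul_nonneg hsab.le hq, mul_pos hsb (neg_pos.2 hp), mul_pos hsa (neg_pos.2 hr)]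
  · have hp : 0 ≤ p := by
      by_contra! hp
      exact h₁ ⟨fun h => absurd h hp.not_ge, fun h => absurd h hq.not_ge⟩
    have hr : 0 ≤ r := by
      by_contra! hr
      exact h₂ ⟨fun h => absurd h hq.not_ge, fun h => absurd h hr.not_ge⟩
    nlinarith [mul_pos hsab (neg_pos.2 hq), mul_nonneg hsb.le hp, mul_nonneg hsa.le hr]

theorem separators_union_eq (ha : 0 < a) (hb : 0 < b) (hab : a + b < π) :
    separators (circlePoint e₁ e₂ 0) (circlePoint e₁ e₂ a) ∪
        separators (circlePoint e₁ e₂ a) (circlePoint e₁ e₂ (a + b)) =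
      separators (circlePoint e₁ e₂ 0) (circlePoint e₁ e₂ (a + b)) := by
  refine Set.Subset.antisymm ?_ (separators_subset_union _ _ _)
  have h := Set.disjoint_left.1 (disjoint_separators_circlePoint (e₁ := e₁) (e₂ := e₂) ha hb hab)
  intro z hz
  have hz' := @h z
  simp only [separators, Set.mem_ofPred_eq, Set.mem_union] at *
  tauto

end Disjoint

theorem reflection_circlePoint {e₁ e₂ : E} (h₁ : ‖e₁‖ = 1) (h₂ : ‖e₂‖ = 1)
    (h₁₂ : inner ℝ e₁ e₂ = 0) (s t : ℝ) :
    (ℝ ∙ circlePoint e₁ e₂ (s / 2)).reflection (circlePoint e₁ e₂ t) =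
      circlePoint e₁ e₂ (s - t) := by
  have hin : inner ℝ (circlePoint e₁ e₂ (s / 2)) (circlePoint e₁ e₂ t) = cos (s / 2 - t) := by
    rw [inner_circlePoint_left, cos_sub]
    simp [circlePoint, inner_add_right, inner_smul_right, h₁, h₂, h₁₂, real_inner_comm e₁ e₂]
  have hnorm : ‖circlePoint e₁ e₂ (s / 2)‖ = 1 := by
    have h : ‖circlePoint e₁ e₂ (s / 2)‖ ^ 2 = 1 := by
      rw [← real_inner_self_eq_norm_sq, inner_circlePoint_left]
      simp [circlePoint, inner_add_right, inner_smul_right, h₁, h₂, h₁₂, real_inner_comm e₁ e₂,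
        ← sq]
    exact (pow_eq_one_iff_of_nonneg (norm_nonneg _) two_ne_zero).1 h
  rw [Submodule.reflection_singleton_apply, hin, hnorm]
  have hs : s - t = s / 2 + (s / 2 - t) := by ring
  have hc : cos (s - t) = 2 * cos (s / 2 - t) * cos (s / 2) - cos t := by
    have h : cos t = cos (s / 2) * cos (s / 2 - t) + sin (s / 2) * sin (s / 2 - t) := by
      rw [← cos_sub, sub_sub_cancel]
    rw [hs, cos_add, h]
    ring
  have hsn : sin (s - t) = 2 * cos (s / 2 - t) * sin (s / 2) - sin t := by
    have h : sin t = sin (s / 2) * cos (s / 2 - t) - cos (s / 2) * sin (s / 2 - t) := by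
      rw [← sin_sub, sub_sub_cancel]
    rw [hs, sin_add, h]
    ring
  simp only [circlePoint, hc, hsn]
  simp
  module

variable [MeasurableSpace E] [BorelSpace E]

theorem measurableSet_separators (x y : E) : MeasurableSet (separators x y) := by
  have h : ∀ w : E, MeasurableSet {z : E | 0 ≤ inner ℝ w z} := fun w =>
    (isClosed_le continuous_const (by fun_prop)).measurableSet
  have : separators x y =
      symmDiff {z : E | 0 ≤ inner ℝ x z} {z : E | 0 ≤ inner ℝ y z} := by
    ext z
    simp only [separators, Set.mem_ofPred_eq, Set.mem_symmDiff]
    tauto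
  rw [this]
  exact (h x).symmDiff (h y)

/-- A form of Sheppard's formula for rotation invariant probability measures. -/
theorem le_measure_separators_circlePoint (μ : Measure E) [IsProbabilityMeasure μ]
    (hinv : ∀ R : E ≃ₗᵢ[ℝ] E, MeasurePreserving R μ μ)
    (hnull : ∀ x : E, x ≠ 0 → μ {z | inner ℝ x z = 0} = 0)
    {e₁ e₂ : E} (h₁ : ‖e₁‖ = 1) (h₂ : ‖e₂‖ = 1) (h₁₂ : inner ℝ e₁ e₂ = 0)
    {θ : ℝ} (hθ : 0 < θ) (hθπ : θ < π) :
    θ / π ≤ μ.real (separators (circlePoint e₁ e₂ 0) (circlePoint e₁ e₂ θ)) := by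
  set c := circlePoint e₁ e₂
  set F : ℝ → ℝ → ℝ := fun a b => μ.real (separators (c a) (c b)) with hF
  have hrefl : ∀ s a b, F a b = F (s - a) (s - b) := by
    intro s a b
    let R := (ℝ ∙ c (s / 2)).reflection
    have hR : ∀ t, R (c t) = c (s - t) := reflection_circlePoint h₁ h₂ h₁₂ s
    have hpre : R ⁻¹' separators (c (s - a)) (c (s - b)) = separators (c a) (c b) := by
      ext z
      simp only [separators, Set.mem_preimage, Set.mem_ofPred_eq, ← hR,
        LinearIsometryEquiv.inner_map_map]
    simp only [hF, Measure.real]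
    rw [← hpre, (hinv R).measure_preimage (measurableSet_separators _ _).nullMeasurableSet]
  have hshift : ∀ a b, F a (a + b) = F 0 b := by
    intro a b
    rw [hrefl (a + b)]
    simp only [hF, add_sub_cancel_left, sub_self]
    rw [separators_comm]
  have hsub : ∀ a b, F 0 (a + b) ≤ F 0 a + F 0 b := by
    intro a b
    rw [← hshift a b]
    exact (measureReal_mono (separators_subset_union _ _ _)).trans (measureReal_union_le _ _)
  have hadd : ∀ a b, 0 < a → 0 < b → a + b < π → F 0 (a + b) = F 0 a + F 0 b := by
    intro a b ha hb hab
    rw [← hshift a b]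
    simp only [hF, c]
    rw [← separators_union_eq ha hb hab, measureReal_union
      (disjoint_separators_circlePoint ha hb hab) (measurableSet_separators _ _)]
  have hnn : ∀ a, 0 ≤ F 0 a := fun a => measureReal_nonneg
  have hpi : F 0 π = 1 := by
    have he : e₁ ≠ 0 := by
      rintro rfl
      simp at h₁
    have hc : (separators (c 0) (c π))ᶜ ⊆ {z | inner ℝ e₁ z = 0} := by
      intro z
      simp only [separators, c, circlePoint, Set.mem_compl_iff, Set.mem_ofPred_eq, not_not]
      simp only [cos_zero, sin_zero, cos_pi, sin_pi, one_smul, zero_smul, add_zero, neg_smul,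
        inner_neg_left]
      intro h
      rcases le_total 0 (inner ℝ e₁ z) with h' | h'
      · exact le_antisymm (by linarith [h.1 h']) h'
      · exact le_antisymm h' (h.2 (by linarith))
    have h0 := measure_mono_null hc (hnull e₁ he)
    rw [prob_compl_eq_zero_iff (measurableSet_separators _ _)] at h0
    simp [hF, Measure.real, h0]
  have hnsub : ∀ (k : ℕ) h, F 0 ((k + 1 : ℕ) * h) ≤ (k + 1 : ℕ) * F 0 h := by
    intro k h
    induction k with
    | zero => simp
    | succ k ih =>
      have := hsub ((k + 1 : ℕ) * h) h
      push_cast at *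
      rw [show ((k : ℝ) + 1 + 1) * h = (k + 1) * h + h by ring]
      linarith
  have hnadd : ∀ (k : ℕ) h, 0 < h → (k + 1 : ℕ) * h < π →
      F 0 ((k + 1 : ℕ) * h) = (k + 1 : ℕ) * F 0 h := by
    intro k h hh
    induction k with
    | zero => simp
    | succ k ih =>
      intro hlt
      have := hadd ((k + 1 : ℕ) * h) h (by positivity) hh (by push_cast at *; linarith)
      have := ih (by push_cast at *; linarith)
      push_cast at *
      rw [show ((k : ℝ) + 1 + 1) * h = (k + 1) * h + h by ring]
      linarith
  have happrox : ∀ N : ℕ, θ / π ≤ F 0 θ + 1 / ((N : ℝ) + 1) := by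
    intro N
    set h := π / ((N : ℝ) + 1) with hh
    have hhpos : 0 < h := by positivity
    have hNh : ((N + 1 : ℕ) : ℝ) * h = π := by
      rw [hh]
      push_cast
      field_simp
    have hFh : 1 / ((N : ℝ) + 1) ≤ F 0 h := by
      have := hnsub N h
      rw [hNh, hpi] at this
      rw [div_le_iff₀ (by positivity)]
      push_cast at this
      linarith
    have hhN : h / π = 1 / ((N : ℝ) + 1) := by
      rw [hh]
      field_simp
    have hceil : 0 < ⌈θ / h⌉₊ := Nat.ceil_pos.2 (by positivity)
    obtain ⟨k, hk⟩ : ∃ k, ⌈θ / h⌉₊ = k + 1 := ⟨_, (Nat.succ_pred_eq_of_pos hceil).symm⟩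
    have hk₁ : θ ≤ (k + 1) * h := by
      have := Nat.le_ceil (θ / h)
      rw [hk, div_le_iff₀ hhpos] at this
      exact_mod_cast this
    have hk₂ : k * h < θ := by
      have : (k : ℝ) < θ / h := Nat.lt_ceil.1 (by omega)
      rwa [lt_div_iff₀ hhpos] at this
    have hkF : k * F 0 h ≤ F 0 θ := by
      rcases k with _ | k
      · simpa using hnn θ
      · rw [← hnadd k h hhpos (hk₂.trans hθπ)]
        have := hadd ((k + 1 : ℕ) * h) (θ - (k + 1 : ℕ) * h) (by positivity) (by linarith)
          (by linarith)
        rw [add_sub_cancel] at this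
        linarith [hnn (θ - (k + 1 : ℕ) * h)]
    calc θ / π ≤ ((k + 1) * h) / π := by gcongr
      _ = k * (1 / ((N : ℝ) + 1)) + 1 / ((N : ℝ) + 1) := by rw [mul_div_assoc, hhN]; ring
      _ ≤ F 0 θ + 1 / ((N : ℝ) + 1) := by
        gcongr
        exact (mul_le_mul_of_nonneg_left hFh k.cast_nonneg).trans hkF
  have hlim := (tendsto_one_div_add_atTop_nhds_zero_nat (𝕜 := ℝ)).const_add (F 0 θ)
  rw [add_zero] at hlim
  exact ge_of_tendsto' hlim happrox

theorem arccos_div_pi_le_measure_separators (μ : Measure E) [IsProbabilityMeasure μ]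
    (hinv : ∀ R : E ≃ₗᵢ[ℝ] E, MeasurePreserving R μ μ)
    (hnull : ∀ x : E, x ≠ 0 → μ {z | inner ℝ x z = 0} = 0)
    {x y : E} {r : ℝ} (hr : 0 < r) (hx : inner ℝ x x = r) (hy : inner ℝ y y = r)
    {ρ : ℝ} (hρ : -1 < ρ) (hρ' : ρ < 1) (hxy : inner ℝ x y = ρ * r) :
    arccos ρ / π ≤ μ.real (separators x y) := by
  have hθ : 0 < arccos ρ := arccos_pos.2 hρ'
  have hθπ : arccos ρ < π := (arccos_le_pi ρ).lt_of_ne fun h => by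
    rw [arccos_eq_pi] at h
    linarith
  have hcos : cos (arccos ρ) = ρ := cos_arccos hρ.le hρ'.le
  have hsin := sin_pos_of_pos_of_lt_pi hθ hθπ
  have hsq := sin_sq_add_cos_sq (arccos ρ)
  set σ := sin (arccos ρ)
  rw [hcos] at hsq
  set q := √r
  have hq : 0 < q := sqrt_pos.2 hr
  have hqr : q ^ 2 = r := sq_sqrt hr.le
  have hyx : inner ℝ y x = ρ * r := by rw [real_inner_comm, hxy]
  have hunit : ∀ e : E, inner ℝ e e = 1 → ‖e‖ = 1 := fun e h => by
    rw [real_inner_self_eq_norm_sq] at h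
    exact (pow_eq_one_iff_of_nonneg (norm_nonneg _) two_ne_zero).1 h
  have key := le_measure_separators_circlePoint μ hinv hnull
    (e₁ := q⁻¹ • x) (e₂ := (q * σ)⁻¹ • (y - ρ • x))
    (hunit _ (by
      simp only [inner_smul_left, inner_smul_right, hx, ← hqr]
      simp
      field_simp))
    (hunit _ (by
      simp only [inner_smul_left, inner_smul_right, inner_sub_left, inner_sub_right, hx, hy, hxy,
        hyx, ← hqr]
      simp
      field_simp
      linear_combination -hsq))
    (by
      simp only [inner_smul_left, inner_smul_right, inner_sub_right, hx, hxy]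
      ring) hθ hθπ
  have h0 : circlePoint (q⁻¹ • x) ((q * σ)⁻¹ • (y - ρ • x)) 0 = q⁻¹ • x := by
    simp [circlePoint]
  have h1 : circlePoint (q⁻¹ • x) ((q * σ)⁻¹ • (y - ρ • x)) (arccos ρ) = q⁻¹ • y := by
    rw [circlePoint, hcos, smul_smul, smul_smul, smul_sub, smul_smul]
    rw [show σ * (q * σ)⁻¹ = q⁻¹ by field_simp]
    module
  rwa [h0, h1, separators_smul_left (inv_pos.2 hq), separators_comm,
    separators_smul_left (inv_pos.2 hq), separators_comm] at key

end HalfSpaces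

section BallMeasure

variable (E : Type*) [NormedAddCommGroup E] [InnerProductSpace ℝ E] [FiniteDimensional ℝ E]
  [MeasurableSpace E] [BorelSpace E]

/-- The uniform probability measure on the unit ball of a Euclidean space. -/
noncomputable def ballMeasure : Measure E := ProbabilityTheory.cond volume (Metric.ball (0 : E) 1)

instance isProbabilityMeasure_ballMeasure : IsProbabilityMeasure (ballMeasure E) :=
  ProbabilityTheory.cond_isProbabilityMeasure_of_finite
    (Metric.measure_ball_pos volume 0 one_pos).ne' measure_ball_lt_top.ne

variable {E}

theorem measurePreserving_ballMeasure (R : E ≃ₗᵢ[ℝ] E) :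
    MeasurePreserving R (ballMeasure E) (ballMeasure E) := by
  have h := (R.measurePreserving.restrict_preimage
    (measurableSet_ball (x := (0 : E)) (ε := 1))).smul_measure
      (volume (Metric.ball (0 : E) 1))⁻¹
  rw [R.preimage_ball, map_zero] at h
  exact h

theorem ballMeasure_hyperplane {x : E} (hx : x ≠ 0) :
    ballMeasure E {z | inner ℝ x z = 0} = 0 := by
  refine ProbabilityTheory.cond_absolutelyContinuous ?_
  have hs : {z : E | inner ℝ x z = 0} = ((ℝ ∙ x)ᗮ : Submodule ℝ E) := by
    ext z
    simp [Submodule.mem_orthogonal_singleton_iff_inner_right]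
  rw [hs]
  refine Measure.addHaar_submodule _ _ fun h => hx ?_
  have : x ∈ (ℝ ∙ x)ᗮ := h ▸ Submodule.mem_top
  simpa [Submodule.mem_orthogonal_singleton_iff_inner_right] using this

end BallMeasure

/-- Cutting finitely many vectors with a random hyperplane. -/
theorem exists_measure_hyperplane_rounding {V E : Type*} [Finite V] [NormedAddCommGroup E]
    [InnerProductSpace ℝ E] [FiniteDimensional ℝ E] (x : V → E) {r : ℝ} (hr : 0 < r)
    (hx : ∀ v, inner ℝ (x v) (x v) = r) {ρ : ℝ} (hρ : -1 < ρ) (hρ' : ρ < 1) :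
    letI : MeasurableSpace (V → Bool) := ⊤
    ∃ μ : Measure (V → Bool), IsProbabilityMeasure μ ∧
      ∀ u v, inner ℝ (x u) (x v) = ρ * r →
        ENNReal.ofReal (arccos ρ / π) ≤ μ {f : V → Bool | f u ≠ f v} := by
  let : MeasurableSpace (V → Bool) := ⊤
  let : MeasurableSpace E := borel E
  have : BorelSpace E := ⟨rfl⟩
  classical
  let S : E → V → Bool := fun z v => decide (0 ≤ inner ℝ (x v) z)
  have hS : Measurable S := by
    refine measurable_to_countable' fun f => ?_
    have : S ⁻¹' {f} = ⋂ v, {z | decide (0 ≤ inner ℝ (x v) z) = f v} := by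
      ext z
      simp [S, funext_iff]
    rw [this]
    refine MeasurableSet.iInter fun v => ?_
    have hcl : MeasurableSet {z : E | 0 ≤ inner ℝ (x v) z} :=
      (isClosed_le continuous_const (by fun_prop)).measurableSet
    cases f v
    · simpa [Set.compl_ofPred] using hcl.compl
    · simpa using hcl
  refine ⟨(ballMeasure E).map S, Measure.isProbabilityMeasure_map hS.aemeasurable, ?_⟩
  intro u v huv
  rw [Measure.map_apply hS MeasurableSpace.measurableSet_top]
  have hpre : S ⁻¹' {f : V → Bool | f u ≠ f v} = separators (x u) (x v) := by
    ext z
    simp [S, separators]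
  rw [hpre]
  refine ENNReal.ofReal_le_of_le_toReal ?_
  exact arccos_div_pi_le_measure_separators (ballMeasure E) measurePreserving_ballMeasure
    (fun _ => ballMeasure_hyperplane) hr (hx u) (hx v) hρ hρ' huv

/-- The number of vertices at depth `j` below a vertex with `δ` hanging `q`-ary trees. -/
noncomputable def hangingMass (q δ : ℝ) : ℕ → ℝ
  | 0 => 1
  | j + 1 => δ * q ^ j

theorem hangingMass_nonneg {q δ : ℝ} (hq : 0 ≤ q) (hδ : 0 ≤ δ) (j : ℕ) :
    0 ≤ hangingMass q δ j := by
  cases j with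
  | zero => exact zero_le_one
  | succ j => exact mul_nonneg hδ (pow_nonneg hq j)

/-- The geometric profile `t ^ k`, truncated at `n`. -/
noncomputable def truncPow (n : ℕ) (t : ℝ) (k : ℕ) : ℝ := if k < n then t ^ k else 0

namespace SimpleGraph

variable {V : Type*} {G : SimpleGraph V} {n : ℕ} {u v : V}

/-- The number of vertices at depth `p.2` hanging below the vertex `p.1` once `G` is completed
to a `(q + 1)`-regular graph by hanging `q`-ary trees. -/
noncomputable def pointMass (G : SimpleGraph V) (n : ℕ) (q : ℝ) (p : V × Fin n) : ℝ :=
  hangingMass q (q + 1 - (G.neighborSet p.1).ncard) p.2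

/-- The distance from `u` to the vertices at depth `p.2` hanging below `p.1`. -/
noncomputable def level (G : SimpleGraph V) (n : ℕ) (u : V) (p : V × Fin n) : ℕ :=
  G.distOr n u p.1 + p.2

theorem Adj.level_eq (hg : (2 * n + 1 : ℕ∞) ≤ G.egirth) (h : G.Adj u v) {p : V × Fin n}
    (hp : G.level n u p < n) :
    G.level n v p = G.level n u p + 1 ∨ G.level n u p = G.level n v p + 1 := by
  unfold level at *
  have := h.distOr_eq hg (w := p.1) (by omega)
  omega

variable [Fintype V]

theorem sum_pointMass_level (hg : (2 * n + 1 : ℕ∞) ≤ G.egirth) (q : ℝ) (u : V) {k : ℕ}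
    (hk : k < n) :
    ∑ p, (if G.level n u p = k then G.pointMass n q p else 0) =
      if k = 0 then 1 else (q + 1) * q ^ (k - 1) := by
  set δ : V → ℝ := fun w => q + 1 - (G.neighborSet w).ncard with hδ
  set T : ℕ → V → ℝ := fun k w =>
    if G.distOr n u w ≤ k then hangingMass q (δ w) (k - G.distOr n u w) else 0 with hT
  have hsum : ∀ k < n,
      ∑ p, (if G.level n u p = k then G.pointMass n q p else 0) = ∑ w, T k w := by
    intro k hk
    rw [Fintype.sum_prod_type]
    refine Finset.sum_congr rfl fun w _ => ?_
    simp only [pointMass, hT]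
    split_ifs with hle
    · rw [Finset.sum_eq_single ⟨k - G.distOr n u w, by omega⟩]
      · simp [level, hle, hδ]
      · intro j _ hj
        refine if_neg fun h => hj (Fin.ext ?_)
        exact (Nat.sub_eq_of_eq_add' h.symm).symm
      · simp
    · refine Finset.sum_eq_zero fun j _ => if_neg fun h => hle ?_
      exact h ▸ Nat.le_add_right _ _
  rw [hsum k hk]
  have hrec : ∀ k, k + 1 < n → ∑ w, T (k + 1) w = q * ∑ w, T k w + if k = 0 then 1 else 0 := by
    intro k hk
    have hpt : ∀ w, T (k + 1) w = q * T k w + (if G.distOr n u w = k + 1 then (1 : ℝ) else 0) -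
        (if G.distOr n u w = k then ((G.neighborSet w).ncard - 1 : ℝ) else 0) := by
      intro w
      simp only [hT]
      rcases lt_trichotomy (G.distOr n u w) k with h | h | h
      · obtain ⟨j, hj⟩ : ∃ j, k - G.distOr n u w = j + 1 := ⟨k - G.distOr n u w - 1, by omega⟩
        have hj' : k + 1 - G.distOr n u w = j + 1 + 1 := by omega
        rw [if_pos (by omega), if_pos h.le, if_neg (by omega), if_neg h.ne, hj, hj']
        simp only [hangingMass]
        ring
      · subst h
        simp [hangingMass, hδ]
        ring
      · rcases (Nat.succ_le_of_lt h).eq_or_lt with h' | h'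
        · simp [← h', hangingMass]
        · rw [if_neg (by omega), if_neg (by omega), if_neg (by omega), if_neg (by omega)]
          simp
    rw [Finset.sum_congr rfl fun w _ => hpt w, Finset.sum_sub_distrib, Finset.sum_add_distrib,
      card_sphere_succ hg hk u, ← Finset.mul_sum]
    ring
  have hzero : ∑ w, T 0 w = 1 := by
    rw [Finset.sum_eq_single u]
    · simp [hT, distOr_self, hangingMass]
    · intro w _ hw
      simp only [hT]
      rw [if_neg]
      intro h
      exact hw ((distOr_eq_zero_iff (by omega)).1 (Nat.le_zero.1 h)).symm
    · simp
  induction k with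
  | zero => simpa using hzero
  | succ k ih =>
    rw [hrec k hk, ih (by omega)]
    rcases k with _ | k
    · simp
    · simp [pow_succ]
      ring

theorem Adj.sum_pointMass_level (hg : (2 * n + 1 : ℕ∞) ≤ G.egirth) (q : ℝ) {k : ℕ}
    (hk : k < n) (h : G.Adj u v) :
    ∑ p, (if G.level n u p = k ∧ G.level n v p = k + 1 then G.pointMass n q p else 0) =
      q ^ k := by
  induction k generalizing u v with
  | zero =>
    have := SimpleGraph.sum_pointMass_level hg q u hk
    rw [if_pos rfl] at this
    rw [pow_zero, ← this]
    refine Finset.sum_congr rfl fun p _ => if_congr ⟨And.left, fun hp => ⟨hp, ?_⟩⟩ rfl rfl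
    have := h.level_eq hg (p := p) (by omega)
    omega
  | succ k ih =>
    have hN := SimpleGraph.sum_pointMass_level hg q u hk
    rw [if_neg (by omega), Nat.add_sub_cancel] at hN
    have hsplit : ∀ p, (if G.level n u p = k + 1 then G.pointMass n q p else 0) =
        (if G.level n u p = k + 1 ∧ G.level n v p = k + 1 + 1 then G.pointMass n q p else 0) +
        (if G.level n v p = k ∧ G.level n u p = k + 1 then G.pointMass n q p else 0) := by
      intro p
      by_cases hp : G.level n u p = k + 1
      · rcases h.level_eq hg (p := p) (by omega) with hv | hv
        · simp [hp, show G.level n v p = k + 1 + 1 by omega,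
            show k + 1 + 1 ≠ k by omega]
        · simp [hp, show G.level n v p = k by omega, show k ≠ k + 1 + 1 by omega]
      · simp [hp]
    rw [Finset.sum_congr rfl fun p _ => hsplit p, Finset.sum_add_distrib,
      ih (by omega) h.symm] at hN
    rw [pow_succ]
    linarith

/-- The vector of coefficients of the block factor at `u`. -/
noncomputable def blockVector (G : SimpleGraph V) (n : ℕ) (q t : ℝ) (u : V) :
    EuclideanSpace ℝ (V × Fin n) :=
  WithLp.toLp 2 fun p => √(G.pointMass n q p) * truncPow n t (G.level n u p)

theorem inner_blockVector {q : ℝ} (hq : 0 ≤ q)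
    (hdeg : ∀ v, ((G.neighborSet v).ncard : ℝ) ≤ q + 1) (t : ℝ) (u v : V) :
    inner ℝ (G.blockVector n q t u) (G.blockVector n q t v) =
      ∑ p, G.pointMass n q p * (truncPow n t (G.level n u p) * truncPow n t (G.level n v p)) := by
  simp only [blockVector, PiLp.inner_apply, RCLike.inner_apply, conj_trivial]
  refine Finset.sum_congr rfl fun p _ => ?_
  have := Real.mul_self_sqrt (hangingMass_nonneg hq (sub_nonneg.2 (hdeg p.1)) p.2)
  change √(G.pointMass n q p) * √(G.pointMass n q p) = G.pointMass n q p at this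
  linear_combination (truncPow n t (G.level n u p) * truncPow n t (G.level n v p)) * this

theorem inner_blockVector_self (hg : (2 * n + 1 : ℕ∞) ≤ G.egirth) (hn : 0 < n) {q t : ℝ}
    (hq : 0 ≤ q) (ht : q * t ^ 2 = 1)
    (hdeg : ∀ v, ((G.neighborSet v).ncard : ℝ) ≤ q + 1) (u : V) :
    inner ℝ (G.blockVector n q t u) (G.blockVector n q t u) =
      1 + (n - 1) * ((q + 1) * t ^ 2) := by
  rw [inner_blockVector hq hdeg]
  have hpt : ∀ p, G.pointMass n q p *
      (truncPow n t (G.level n u p) * truncPow n t (G.level n u p)) =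
      ∑ k ∈ Finset.range n, t ^ (2 * k) *
        (if G.level n u p = k then G.pointMass n q p else 0) := by
    intro p
    by_cases hp : G.level n u p < n
    · simp [truncPow, hp]
      ring
    · rw [Finset.sum_eq_zero]
      · simp [truncPow, hp]
      · intro k hk
        rw [if_neg, mul_zero]
        rintro rfl
        exact hp (Finset.mem_range.1 hk)
  rw [Finset.sum_congr rfl fun p _ => hpt p, Finset.sum_comm]
  have hk : ∀ k ∈ Finset.range n, ∑ p, t ^ (2 * k) *
      (if G.level n u p = k then G.pointMass n q p else 0) =
      if k = 0 then 1 else (q + 1) * t ^ 2 := by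
    intro k hk
    rw [← Finset.mul_sum, sum_pointMass_level hg q u (Finset.mem_range.1 hk)]
    rcases k with _ | k
    · simp
    · simp only [Nat.add_sub_cancel, Nat.add_eq_zero_iff, one_ne_zero, and_false, if_false]
      have : q ^ k * (t ^ 2) ^ k = 1 := by rw [← mul_pow, ht, one_pow]
      rw [mul_add, pow_add, pow_mul]
      linear_combination (q + 1) * t ^ 2 * this
  rw [Finset.sum_congr rfl hk]
  obtain ⟨m, rfl⟩ : ∃ m, n = m + 1 := ⟨n - 1, by omega⟩
  rw [Finset.sum_range_succ']
  simp
  ring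

theorem Adj.inner_blockVector (hg : (2 * n + 1 : ℕ∞) ≤ G.egirth) (hn : 0 < n) {q t : ℝ}
    (hq : 0 ≤ q) (ht : q * t ^ 2 = 1)
    (hdeg : ∀ v, ((G.neighborSet v).ncard : ℝ) ≤ q + 1) (h : G.Adj u v) :
    inner ℝ (G.blockVector n q t u) (G.blockVector n q t v) = (n - 1) * (2 * t) := by
  rw [SimpleGraph.inner_blockVector hq hdeg]
  obtain ⟨m, rfl⟩ : ∃ m, n = m + 1 := ⟨n - 1, by omega⟩
  have hpt : ∀ p, G.pointMass (m + 1) q p *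
      (truncPow (m + 1) t (G.level (m + 1) u p) * truncPow (m + 1) t (G.level (m + 1) v p)) =
      ∑ k ∈ Finset.range m, t ^ (2 * k + 1) *
        ((if G.level (m + 1) u p = k ∧ G.level (m + 1) v p = k + 1 then
            G.pointMass (m + 1) q p else 0) +
          (if G.level (m + 1) v p = k ∧ G.level (m + 1) u p = k + 1 then
            G.pointMass (m + 1) q p else 0)) := by
    intro p
    by_cases hp : G.level (m + 1) u p < m + 1 ∧ G.level (m + 1) v p < m + 1
    · rcases h.level_eq hg hp.1 with hv | hv
      · rw [Finset.sum_eq_single (G.level (m + 1) u p)]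
        · simp [truncPow, hp.1, hv, show G.level (m + 1) u p < m by omega]
          ring
        · intro k _ hk
          rw [if_neg (by omega), if_neg (by omega)]
          simp
        · simp only [Finset.mem_range]
          omega
      · rw [Finset.sum_eq_single (G.level (m + 1) v p)]
        · simp [truncPow, hp.2, hv, show G.level (m + 1) v p < m by omega]
          ring
        · intro k _ hk
          rw [if_neg (by omega), if_neg (by omega)]
          simp
        · simp only [Finset.mem_range]
          omega
    · rw [Finset.sum_eq_zero]
      · rcases not_and_or.1 hp with hp | hp <;> simp [truncPow, hp]
      · intro k hk
        have := Finset.mem_range.1 hk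
        rw [if_neg (by omega), if_neg (by omega)]
        simp
  rw [Finset.sum_congr rfl fun p _ => hpt p, Finset.sum_comm]
  have hk : ∀ k ∈ Finset.range m, ∑ p, t ^ (2 * k + 1) *
        ((if G.level (m + 1) u p = k ∧ G.level (m + 1) v p = k + 1 then
            G.pointMass (m + 1) q p else 0) +
          (if G.level (m + 1) v p = k ∧ G.level (m + 1) u p = k + 1 then
            G.pointMass (m + 1) q p else 0)) = 2 * t := by
    intro k hk
    have hkm := Finset.mem_range.1 hk
    rw [← Finset.mul_sum, Finset.sum_add_distrib, h.sum_pointMass_level hg q (by omega),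
      h.symm.sum_pointMass_level hg q (by omega)]
    have : q ^ k * (t ^ 2) ^ k = 1 := by rw [← mul_pow, ht, one_pow]
    rw [pow_succ, pow_mul]
    linear_combination 2 * t * this
  rw [Finset.sum_congr rfl hk]
  simp

end SimpleGraph

/-- If `G` is a finite graph of maximum degree at most `d` and girth at least `2n+1`,
then there is a probability measure on `V → {0,1}` (all subsets measurable) giving each
edge probability at least `(1/π) arccos(-(2√(d-1)/d)/(1 + (d-1)/(d(n-1))))` of being cut. -/
theorem exists_random_edge_cut {V : Type*} [Fintype V]
    (d n : ℕ) (hd : 3 ≤ d) (hn : 2 ≤ n)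
    (G : SimpleGraph V) (hdeg : ∀ v : V, (G.neighborSet v).ncard ≤ d)
    (hgirth : (2 * n + 1 : ℕ∞) ≤ G.egirth) :
    letI : MeasurableSpace (V → Bool) := ⊤
    ∃ μ : Measure (V → Bool), IsProbabilityMeasure μ ∧
      ∀ u v : V, G.Adj u v →
        ENNReal.ofReal ((1 / π) * Real.arccos
            (-(2 * Real.sqrt ((d : ℝ) - 1) / (d : ℝ)) /
              (1 + ((d : ℝ) - 1) / ((d : ℝ) * ((n : ℝ) - 1)))))
          ≤ μ {f : V → Bool | f u ≠ f v} := by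
  have hd' : (3 : ℝ) ≤ d := by exact_mod_cast hd
  have hn' : (2 : ℝ) ≤ n := by exact_mod_cast hn
  set q : ℝ := (d : ℝ) - 1 with hq
  have hdq : (d : ℝ) = q + 1 := by ring
  have hq2 : 2 ≤ q := by linarith
  set m : ℝ := (n : ℝ) - 1 with hm
  have hm1 : 1 ≤ m := by linarith
  set s := √q with hs
  have hs0 : 0 < s := sqrt_pos.2 (by linarith)
  have hsq : s ^ 2 = q := sq_sqrt (by linarith)
  have ht : q * (-s⁻¹) ^ 2 = 1 := by
    rw [← hsq]
    field_simp
  set ρ := -(2 * s / (d : ℝ)) / (1 + q / ((d : ℝ) * m)) with hρ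
  set r := 1 + m * ((q + 1) * (-s⁻¹) ^ 2) with hr
  have hr0 : 0 < r := by positivity
  have hρr : ρ * r = m * (2 * -s⁻¹) := by
    rw [hρ, hr, hdq, ← hsq]
    field_simp
    ring
  have hρ0 : ρ < 0 := by
    rw [hρ, neg_div, neg_lt_zero]
    positivity
  have hρ1 : -1 < ρ := by
    rw [hρ, neg_div, neg_lt_neg_iff, div_lt_one (by positivity)]
    have h₁ : 2 * s / (d : ℝ) ≤ 1 := by
      rw [div_le_one (by linarith), hdq, ← hsq]
      nlinarith [sq_nonneg (s - 1)]
    have h₂ : 0 < q / ((d : ℝ) * m) := by positivity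
    linarith
  have hdeg' : ∀ v, ((G.neighborSet v).ncard : ℝ) ≤ q + 1 := fun v => by
    rw [← hdq]
    exact_mod_cast hdeg v
  obtain ⟨μ, hμ, hcut⟩ := exists_measure_hyperplane_rounding (G.blockVector n q (-s⁻¹)) hr0
    (SimpleGraph.inner_blockVector_self hgirth (by omega) (by linarith) ht hdeg')
    hρ1 (by linarith)
  refine ⟨μ, hμ, fun u v huv => ?_⟩
  rw [one_div_mul_eq_div]
  exact hcut u v (by
    rw [huv.inner_blockVector hgirth (by omega) (by linarith) ht hdeg', hρr])
end

section
/- Let d ≥ 3 and n ≥ 2 be natural numbers, and let G be a simple graph on a finite vertex set V such that every vertex has degree at most d and the girth of G is at least 2n+1. Then there exists a subset S ⊆ V such that the number of edges of G with exactly one endpoint in S is at least (1/π)·arccos( −(2√(d−1)/d) / (1 + (d−1)/(d·(n−1))) ) times the total number of edges of G. -/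
open Real

section Gaussian

open MeasureTheory ProbabilityTheory

theorem stdGaussian_map_adjoint {E F : Type*} [NormedAddCommGroup E] [InnerProductSpace ℝ E]
    [FiniteDimensional ℝ E] [MeasurableSpace E] [BorelSpace E]
    [NormedAddCommGroup F] [InnerProductSpace ℝ F]
    [FiniteDimensional ℝ F] [MeasurableSpace F] [BorelSpace F] (J : F →ₗᵢ[ℝ] E) :
    (stdGaussian E).map (J.toContinuousLinearMap.adjoint) = stdGaussian F := by
  have hm : Measurable (J.toContinuousLinearMap.adjoint) := by fun_prop
  have := Measure.isProbabilityMeasure_map (μ := stdGaussian E) hm.aemeasurable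
  refine Measure.ext_of_charFun ?_
  ext t
  rw [charFun_apply, integral_map hm.aemeasurable (by fun_prop)]
  simp_rw [ContinuousLinearMap.adjoint_inner_left]
  have h := charFun_stdGaussian (E := E) (J t)
  rw [charFun_apply] at h
  rw [charFun_stdGaussian]
  simpa using h

theorem stdGaussian_complex_singleton_zero : stdGaussian ℂ {0} = 0 := by
  have h := IsGaussian.map_eq_gaussianReal (μ := stdGaussian ℂ) (Complex.reCLM)
  rw [variance_dual_stdGaussian] at h
  have h2 := nullSingletonClass_gaussianReal (μ := (stdGaussian ℂ)[Complex.reCLM]) (v := (‖Complex.reCLM‖ ^ 2).toNNReal) (by simp)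
  have h3 : (stdGaussian ℂ).map Complex.reCLM {0} = 0 := by
    rw [h]; exact measure_singleton _
  rw [Measure.map_apply (by fun_prop) (measurableSet_singleton _)] at h3
  exact measure_mono_null (by intro x; simp; rintro rfl; simp) h3

instance fact_two_mul_pi_pos : Fact (0 < 2 * π) := ⟨by positivity⟩

theorem map_arg_stdGaussian :
    (stdGaussian ℂ).map (fun w => ((Complex.arg w : ℝ) : AddCircle (2 * π)))
      = ENNReal.ofReal (2 * π)⁻¹ • (volume : Measure (AddCircle (2 * π))) := by
  have hm : Measurable (fun w => ((Complex.arg w : ℝ) : AddCircle (2 * π))) :=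
    AddCircle.measurable_mk'.comp Complex.measurable_arg
  set ν := (stdGaussian ℂ).map (fun w => ((Complex.arg w : ℝ) : AddCircle (2 * π))) with hν
  have hp : IsProbabilityMeasure ν := Measure.isProbabilityMeasure_map hm.aemeasurable
  have hinv : ν.IsAddLeftInvariant := by
    constructor
    intro a
    obtain ⟨t, rfl⟩ := QuotientAddGroup.mk_surjective a
    have hrot := stdGaussian_map (rotation (Circle.exp t))
    rw [hν, Measure.map_map (by fun_prop) hm]
    conv_rhs => rw [← hrot]
    rw [Measure.map_map hm (by fun_prop)]
    refine Measure.map_congr ?_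
    have h0 : ∀ᵐ w ∂(stdGaussian ℂ), w ≠ 0 := by
      simpa [ae_iff] using stdGaussian_complex_singleton_zero
    filter_upwards [h0] with w hw
    have := Complex.arg_mul_coe_angle (x := Complex.exp (t * Complex.I)) (y := w) (by simp) hw
    have h4 : ((Complex.arg (Complex.exp (t * Complex.I)) : ℝ) : Real.Angle) = t := by
      rw [Complex.arg_exp_mul_I]
      exact Real.Angle.coe_toIocMod _ _
    rw [h4] at this
    simp only [Function.comp, rotation_apply, Circle.coe_exp]
    exact this.symm
  have h := Measure.isAddLeftInvariant_eq_smul ν (volume : Measure (AddCircle (2 * π)))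
  have h1 := congrArg (fun m => m Set.univ) h
  simp only [measure_univ, Measure.smul_apply, AddCircle.measure_univ] at h1
  rw [h]
  set c := ν.addHaarScalarFactor (volume : Measure (AddCircle (2 * π)))
  have h2 : (c : ENNReal) * ENNReal.ofReal (2 * π) = 1 := h1.symm
  rw [ENNReal.ofReal_inv_of_pos (by positivity), ← ENNReal.eq_inv_of_mul_eq_one_left h2]
  rfl

theorem angle_le_stdGaussian_complex {θ : ℝ} (h0 : 0 ≤ θ) (hπ : θ ≤ π) :
    ENNReal.ofReal (θ / (2 * π)) ≤
      stdGaussian ℂ {w | 0 < w.re ∧ cos θ * w.re + sin θ * w.im ≤ 0} := by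
  have hm : Measurable (fun w => ((Complex.arg w : ℝ) : AddCircle (2 * π))) :=
    AddCircle.measurable_mk'.comp Complex.measurable_arg
  set A : Set (AddCircle (2 * π)) :=
    
    {α | 0 < Real.Angle.cos α ∧ Real.Angle.cos (α - ((θ : ℝ) : AddCircle (2 * π))) ≤ 0} with hA
  have hc1 : Continuous (fun α : AddCircle (2 * π) => Real.Angle.cos α) :=
    Real.Angle.continuous_cos
  have hc2 : Continuous (fun α : AddCircle (2 * π) =>
      Real.Angle.cos (α - ((θ : ℝ) : AddCircle (2 * π)))) :=
    hc1.comp (continuous_id.sub continuous_const)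
  have hAm : MeasurableSet A :=
    (measurableSet_lt measurable_const hc1.measurable).inter
      (measurableSet_le hc2.measurable measurable_const)
  have hvol : ENNReal.ofReal θ ≤ volume A := by
    rw [AddCircle.add_projection_respects_measure (2 * π) (-π) hAm]
    have : ENNReal.ofReal θ = volume (Set.Ioo (-(π / 2)) (θ - π / 2)) := by
      rw [Real.volume_Ioo]; congr 1; ring
    rw [this]
    refine measure_mono fun t ht => ⟨⟨?_, ?_⟩, ?_, ?_⟩
    · exact cos_pos_of_mem_Ioo ⟨ht.1, by linarith [ht.2]⟩
    · change cos (t - θ) ≤ 0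
      rw [← cos_neg]
      exact cos_nonpos_of_pi_div_two_le_of_le (by linarith [ht.2]) (by linarith [ht.1])
    · linarith [ht.1, pi_pos]
    · linarith [ht.2, pi_pos]
  have key : ENNReal.ofReal (θ / (2 * π)) ≤
      (stdGaussian ℂ).map (fun w => ((Complex.arg w : ℝ) : AddCircle (2 * π))) A := by
    rw [map_arg_stdGaussian, Measure.smul_apply, smul_eq_mul, div_eq_inv_mul,
      ENNReal.ofReal_mul (by positivity)]
    gcongr
  refine key.trans ?_
  rw [Measure.map_apply hm hAm]
  refine measure_mono_ae ?_
  have hne : ∀ᵐ w ∂(stdGaussian ℂ), w ≠ 0 := by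
    simpa [ae_iff] using stdGaussian_complex_singleton_zero
  filter_upwards [hne] with w hw0 hw
  obtain ⟨h1, h2⟩ := hw
  change 0 < cos (Complex.arg w) at h1
  change cos (Complex.arg w - θ) ≤ 0 at h2
  replace hw0 : 0 < ‖w‖ := norm_pos_iff.mpr hw0
  rw [cos_sub] at h2
  change 0 < w.re ∧ _ ≤ (0 : ℝ)
  rw [← Complex.norm_mul_cos_arg w, ← Complex.norm_mul_sin_arg w]
  refine ⟨by positivity, ?_⟩
  have := mul_nonpos_of_nonneg_of_nonpos hw0.le h2
  linarith

open InnerProductGeometry in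
theorem angle_le_stdGaussian {E : Type*} [NormedAddCommGroup E] [InnerProductSpace ℝ E]
    [FiniteDimensional ℝ E] [MeasurableSpace E] [BorelSpace E] {a b : E}
    (ha : a ≠ 0) (hb : b ≠ 0) (h0 : angle a b ≠ 0) (hπ : angle a b ≠ π) :
    ENNReal.ofReal (angle a b / (2 * π)) ≤
      stdGaussian E {z | 0 < inner ℝ a z ∧ inner ℝ b z ≤ 0} := by
  set θ := angle a b with hθ
  have hs : sin θ ≠ 0 := by
    rw [Ne, sin_eq_zero_iff_angle_eq_zero_or_angle_eq_pi]
    tauto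
  have hna : ‖a‖ ≠ 0 := norm_ne_zero_iff.mpr ha
  have hnb : ‖b‖ ≠ 0 := norm_ne_zero_iff.mpr hb
  have hab : inner ℝ a b = cos θ * (‖a‖ * ‖b‖) := (cos_angle_mul_norm_mul_norm a b).symm
  set e : E := (sin θ)⁻¹ • (‖b‖⁻¹ • b - (cos θ * ‖a‖⁻¹) • a) with he
  have hae : inner ℝ a e = 0 := by
    rw [he, inner_smul_right, inner_sub_right, inner_smul_right, inner_smul_right, hab,
      real_inner_self_eq_norm_sq]
    field_simp
    ring
  have hee : inner ℝ e e = 1 := by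
    have h1 : inner ℝ e e = (sin θ)⁻¹ * (‖b‖⁻¹ * inner ℝ e b) := by
      conv_lhs => arg 3; rw [he]
      rw [inner_smul_right, inner_sub_right, inner_smul_right, inner_smul_right,
        real_inner_comm a e, hae]
      ring
    rw [h1, he, inner_smul_left, inner_sub_left, inner_smul_left, inner_smul_left, hab,
      real_inner_self_eq_norm_sq]
    simp only [conj_trivial]
    field_simp
    have := sin_sq_add_cos_sq θ
    linarith
  have hb' (z : E) : inner ℝ b z = ‖b‖ * (cos θ * (‖a‖⁻¹ * inner ℝ a z) + sin θ * inner ℝ e z) := by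
    rw [he, inner_smul_left, inner_sub_left, inner_smul_left, inner_smul_left]
    simp only [conj_trivial]
    field_simp
    ring
  let J : ℂ →ₗᵢ[ℝ] E :=
    { toFun := fun w => w.re • (‖a‖⁻¹ • a) + w.im • e
      map_add' := fun x y => by simp only [Complex.add_re, Complex.add_im]; module
      map_smul' := fun r x => by
        simp only [Complex.real_smul, Complex.re_ofReal_mul, Complex.im_ofReal_mul,
          RingHom.id_apply]
        module
      norm_map' := fun w => by
        have h : ‖w.re • (‖a‖⁻¹ • a) + w.im • e‖ ^ 2 = ‖w‖ ^ 2 := by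
          rw [Complex.sq_norm, Complex.normSq_apply, norm_add_sq_real, norm_smul, norm_smul,
            norm_smul, inner_smul_left, inner_smul_left, inner_smul_right, hae, mul_pow, mul_pow,
            mul_pow, ← real_inner_self_eq_norm_sq e, hee]
          simp
          field_simp
        exact (sq_eq_sq₀ (norm_nonneg _) (norm_nonneg _)).mp h }
  have hJ1 (z : E) : (J.toContinuousLinearMap.adjoint z).re = ‖a‖⁻¹ * inner ℝ a z := by
    have := ContinuousLinearMap.adjoint_inner_right J.toContinuousLinearMap 1 z
    simpa [J, inner_smul_left] using this
  have hJI (z : E) : (J.toContinuousLinearMap.adjoint z).im = inner ℝ e z := by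
    have := ContinuousLinearMap.adjoint_inner_right J.toContinuousLinearMap Complex.I z
    simpa [J] using this
  refine (angle_le_stdGaussian_complex (angle_nonneg a b) (angle_le_pi a b)).trans ?_
  have hW : MeasurableSet {w : ℂ | 0 < w.re ∧ cos θ * w.re + sin θ * w.im ≤ 0} := by
    have h1 : MeasurableSet {w : ℂ | 0 < w.re} := measurableSet_lt (by fun_prop) (by fun_prop)
    have h2 : MeasurableSet {w : ℂ | cos θ * w.re + sin θ * w.im ≤ 0} :=
      measurableSet_le (by fun_prop) (by fun_prop)
    exact h1.inter h2
  rw [← stdGaussian_map_adjoint J, Measure.map_apply (by fun_prop) hW]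
  refine measure_mono fun z hz => ?_
  obtain ⟨h1, h2⟩ := hz
  rw [hJ1] at h1 h2
  rw [hJI] at h2
  refine ⟨(mul_pos_iff_of_pos_left (by positivity)).mp h1, ?_⟩
  rw [hb']
  exact mul_nonpos_of_nonneg_of_nonpos (norm_nonneg b) h2

theorem exists_edge_cut_of_angle {V E : Type*} [Fintype V] (G : SimpleGraph V)
    [NormedAddCommGroup E] [InnerProductSpace ℝ E] [FiniteDimensional ℝ E]
    {φ : ℝ} (h0 : 0 < φ) (hπ : φ < π) (X : V → E) (hX : ∀ u v, G.Adj u v → X u ≠ 0)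
    (hadj : ∀ u v, G.Adj u v → InnerProductGeometry.angle (X u) (X v) = φ) :
    ∃ S : Set V, φ / π * (G.edgeSet.ncard : ℝ) ≤
      ({e ∈ G.edgeSet | ∃ u v : V, e = s(u, v) ∧ u ∈ S ∧ v ∉ S}.ncard : ℝ) := by
  classical
  let _ : MeasurableSpace E := borel E
  have _ : BorelSpace E := ⟨rfl⟩
  let A (p : G.Dart) : Set E := {z | 0 < inner ℝ (X p.fst) z ∧ inner ℝ (X p.snd) z ≤ 0}
  have hA (p : G.Dart) : MeasurableSet (A p) := by
    have h1 : MeasurableSet {z | 0 < inner ℝ (X p.fst) z} :=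
      measurableSet_lt (by fun_prop) (by fun_prop)
    have h2 : MeasurableSet {z | inner ℝ (X p.snd) z ≤ 0} :=
      measurableSet_le (by fun_prop) (by fun_prop)
    exact h1.inter h2
  have hint (p : G.Dart) : Integrable ((A p).indicator (1 : E → ℝ)) (stdGaussian E) :=
    (integrable_const 1).indicator (hA p)
  obtain ⟨z, hz⟩ := exists_integral_le (μ := stdGaussian E)
    (f := fun z => ∑ p : G.Dart, (A p).indicator (1 : E → ℝ) z)
    (integrable_finsetSum _ fun p _ => hint p)
  refine ⟨{v | 0 < inner ℝ (X v) z}, ?_⟩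
  rw [integral_finsetSum _ fun p _ => hint p] at hz
  have hlow (p : G.Dart) :
      φ / (2 * π) ≤ ∫ z, (A p).indicator (1 : E → ℝ) z ∂(stdGaussian E) := by
    rw [integral_indicator_one (hA p), measureReal_def,
      ← ENNReal.ofReal_le_iff_le_toReal (measure_ne_top _ _)]
    have h := hadj _ _ p.adj
    have := angle_le_stdGaussian (hX _ _ p.adj) (hX _ _ p.adj.symm)
      (by rw [h]; exact h0.ne') (by rw [h]; exact hπ.ne)
    rwa [h] at this
  have hsum := (Finset.sum_le_sum fun p (_ : p ∈ Finset.univ) => hlow p).trans hz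
  rw [Finset.sum_const, Finset.card_univ, G.dart_card_eq_twice_card_edges, nsmul_eq_mul,
    ← Set.ncard_coe_finset, SimpleGraph.coe_edgeFinset] at hsum
  have hcard : ∑ p : G.Dart, (A p).indicator (1 : E → ℝ) z =
      ((Finset.univ.filter fun p : G.Dart => z ∈ A p).card : ℝ) := by
    rw [Finset.card_filter]
    push_cast
    exact Finset.sum_congr rfl fun p _ => by by_cases h : z ∈ A p <;> simp [h]
  rw [hcard] at hsum
  refine le_trans (le_of_eq ?_) (hsum.trans ?_)
  · push_cast
    field_simp
  · rw [← Set.ncard_coe_finset]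
    refine Nat.cast_le.mpr (Set.ncard_le_ncard_of_injOn (fun p : G.Dart => p.edge) ?_ ?_
      (Set.toFinite _))
    · intro p hp
      simp only [Finset.coe_filter, Finset.mem_univ, true_and, Set.mem_ofPred_eq] at hp
      exact ⟨p.edge_mem, p.fst, p.snd, rfl, hp.1, not_lt.mpr hp.2⟩
    · intro p hp q hq hpq
      simp only [Finset.coe_filter, Finset.mem_univ, true_and, Set.mem_ofPred_eq] at hp hq
      rcases SimpleGraph.dart_edge_eq_iff p q |>.mp hpq with h | h
      · exact h
      · subst h
        exact absurd hq.2 (not_le.mpr hp.1)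

end Gaussian

namespace SimpleGraph

theorem eq_of_isPath_of_length_add_length_lt_egirth {V : Type*} {G : SimpleGraph V} {u w : V}
    {p q : G.Walk u w} (hp : p.IsPath) (hq : q.IsPath)
    (h : ((p.length + q.length : ℕ) : ℕ∞) < G.egirth) : p = q := by
  let H : SimpleGraph V := fromEdgeSet {e | e ∈ p.edges ∨ e ∈ q.edges}
  have hH (e : Sym2 V) (he : e ∈ G.edgeSet) (h : e ∈ p.edges ∨ e ∈ q.edges) : e ∈ H.edgeSet := by
    rw [edgeSet_fromEdgeSet]
    exact ⟨h, G.not_isDiag_of_mem_edgeSet he⟩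
  have hpH : ∀ e ∈ p.edges, e ∈ H.edgeSet := fun e he =>
    hH e (p.edges_subset_edgeSet he) (.inl he)
  have hqH : ∀ e ∈ q.edges, e ∈ H.edgeSet := fun e he =>
    hH e (q.edges_subset_edgeSet he) (.inr he)
  have hedge (e : Sym2 V) (he : e ∈ H.edgeSet) : e ∈ p.edges ++ q.edges := by
    rw [edgeSet_fromEdgeSet] at he
    exact List.mem_append.mpr he.1
  have hle : H ≤ G := by
    rw [← edgeSet_subset_edgeSet]
    intro e he
    rcases List.mem_append.mp (hedge e he) with h | h
    exacts [p.edges_subset_edgeSet h, q.edges_subset_edgeSet h]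
  have hac : H.IsAcyclic := by
    intro v c hc
    have h1 : G.egirth ≤ (c.mapLe hle).length := egirth_le_length (hc.mapLe hle)
    have h2 : c.edges.length ≤ (p.edges ++ q.edges).length :=
      (hc.isTrail.edges_nodup.subperm fun e he => hedge e (c.edges_subset_edgeSet he)).length_le
    have h3 : c.length ≤ p.length + q.length := by simpa using h2
    refine absurd (h.trans_le h1) (not_lt.mpr ?_)
    simpa using (Nat.cast_le (α := ℕ∞)).mpr h3
  have heq := (hac.subsingleton_path u w).elim ⟨p.transfer H hpH, hp.transfer hpH⟩
    ⟨q.transfer H hqH, hq.transfer hqH⟩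
  have heq' : p.transfer H hpH = q.transfer H hqH := congrArg Subtype.val heq
  have hs := congrArg Walk.support heq'
  simp only [Walk.support_transfer] at hs
  exact Walk.ext_support hs

/-- Paths of total length at most `2r+2` with common endpoints coincide. -/
def UniqueShortPaths {V : Type*} (G : SimpleGraph V) (r : ℕ) : Prop :=
  ∀ ⦃u w : V⦄ ⦃p q : G.Walk u w⦄, p.IsPath → q.IsPath → p.length + q.length ≤ 2 * r + 2 → p = q

section

variable {V : Type*} [Fintype V] (G : SimpleGraph V) (d r : ℕ)

open Classical in
/-- The basis vector at depth `k` of the virtual tree attached to `u`, or zero if `k > r`. -/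
noncomputable def depthVec (u : V) (k : ℕ) : EuclideanSpace ℝ (V × Fin (r + 1)) :=
  if h : k < r + 1 then EuclideanSpace.single (u, ⟨k, h⟩) 1 else 0

open Classical in
/-- The indicator vector of the vertices at distance `k` from `u`, on the side of `u` not
containing its neighbour `v`, where `u` is completed to degree `d` by virtual trees whose
levels are merged into single coordinates. -/
noncomputable def branchVec : ℕ → V → V → EuclideanSpace ℝ (V × Fin (r + 1))
  | 0, _, u => depthVec r u 0
  | k + 1, v, u => ∑ x ∈ (G.neighborFinset u).erase v, branchVec k u x +
      √(((d : ℝ) - G.degree u) * ((d : ℝ) - 1) ^ k) • depthVec r u (k + 1)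

open Classical in
/-- The indicator vector of the sphere of radius `k` around `u`, after completion by
virtual trees. -/
noncomputable def sphereVec : ℕ → V → EuclideanSpace ℝ (V × Fin (r + 1))
  | 0, u => depthVec r u 0
  | k + 1, u => ∑ x ∈ G.neighborFinset u, branchVec G d r k u x +
      √(((d : ℝ) - G.degree u) * ((d : ℝ) - 1) ^ k) • depthVec r u (k + 1)

variable {G d r}

omit [Fintype V] in
theorem depthVec_apply_ne_zero {u w : V} {k : ℕ} {j : Fin (r + 1)}
    (h : depthVec r u k (w, j) ≠ 0) : w = u ∧ (j : ℕ) = k := by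
  unfold depthVec at h
  split_ifs at h with hk
  · simp only [PiLp.single_apply, ne_eq, ite_eq_right_iff, one_ne_zero, imp_false, not_not,
      Prod.mk.injEq] at h
    exact ⟨h.1, by rw [h.2]⟩
  · simp at h

theorem inner_depthVec_self (u : V) {k : ℕ} (hk : k < r + 1) :
    inner ℝ (depthVec r u k) (depthVec r u k) = 1 := by
  simp [depthVec, hk]

theorem sphereVec_succ {u v : V} (h : G.Adj u v) (k : ℕ) :
    sphereVec G d r (k + 1) u = branchVec G d r (k + 1) v u + branchVec G d r k u v := by
  classical
  have hv : v ∈ G.neighborFinset u := by simpa using h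
  rw [sphereVec, branchVec, ← Finset.sum_erase_add _ _ hv]
  abel

theorem exists_isPath_of_branchVec_apply_ne_zero (hu : G.UniqueShortPaths r) {k : ℕ}
    (hk : k ≤ r) {v u w : V} {j : Fin (r + 1)} (h : G.Adj v u)
    (hne : branchVec G d r k v u (w, j) ≠ 0) :
    ∃ p : G.Walk u w, p.IsPath ∧ v ∉ p.support ∧ p.length + j = k := by
  classical
  induction k generalizing v u with
  | zero =>
    obtain ⟨rfl, hj⟩ := depthVec_apply_ne_zero hne
    exact ⟨Walk.nil, by simp, by simpa using h.ne, by simpa using hj⟩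
  | succ k ih =>
    rw [branchVec, PiLp.add_apply] at hne
    by_cases h1 : depthVec r u (k + 1) (w, j) ≠ 0
    · obtain ⟨rfl, hj⟩ := depthVec_apply_ne_zero h1
      exact ⟨Walk.nil, by simp, by simpa using h.ne, by simpa using hj⟩
    · rw [not_not] at h1
      rw [PiLp.smul_apply, h1, smul_zero, add_zero] at hne
      have hne' : ∑ x ∈ (G.neighborFinset u).erase v, branchVec G d r k u x (w, j) ≠ 0 := by
        simpa using hne
      obtain ⟨x, hx, hxne⟩ := Finset.exists_ne_zero_of_sum_ne_zero hne'
      rw [Finset.mem_erase, mem_neighborFinset] at hx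
      obtain ⟨p, hp, hup, hlen⟩ := ih (by omega) hx.2 hxne
      refine ⟨Walk.cons hx.2 p, hp.cons hup, ?_, by simp; omega⟩
      rw [Walk.support_cons, List.mem_cons, not_or]
      refine ⟨h.ne, fun hv => hx.1 ?_⟩
      have hlt := p.length_takeUntil_le_length hv
      have heq := hu (p := Walk.cons hx.2 (p.takeUntil v hv)) (q := Walk.cons h.symm Walk.nil)
        ((hp.takeUntil hv).cons fun hmem => hup (p.support_takeUntil_subset_support hv hmem))
        (by simpa using h.ne') (by simp; omega)
      exact (Walk.cons.inj heq).1

theorem inner_eq_zero_of_disjoint {ι : Type*} [Fintype ι] {x y : EuclideanSpace ℝ ι}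
    (h : ∀ i, x i ≠ 0 → y i ≠ 0 → False) : inner ℝ x y = 0 := by
  rw [PiLp.inner_apply]
  refine Finset.sum_eq_zero fun i _ => ?_
  by_cases hx : x i = 0
  · simp [hx]
  · have : y i = 0 := by_contra fun hy => h i hx hy
    simp [this]

theorem inner_branchVec_of_ne_child (hu : G.UniqueShortPaths r) {k : ℕ} (hk : k ≤ r) {u x y : V}
    (hx : G.Adj u x) (hy : G.Adj u y) (hxy : x ≠ y) :
    inner ℝ (branchVec G d r k u x) (branchVec G d r k u y) = 0 := by
  refine inner_eq_zero_of_disjoint fun ⟨w, j⟩ h1 h2 => hxy ?_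
  obtain ⟨p, hp, hup, hpl⟩ := exists_isPath_of_branchVec_apply_ne_zero hu hk hx h1
  obtain ⟨q, hq, huq, hql⟩ := exists_isPath_of_branchVec_apply_ne_zero hu hk hy h2
  have heq := hu (hp.cons (h := hx) hup) (hq.cons (h := hy) huq) (by simp; omega)
  exact (Walk.cons.inj heq).1

theorem inner_branchVec_depthVec (hu : G.UniqueShortPaths r) {k : ℕ} (hk : k ≤ r) {u x : V}
    (hx : G.Adj u x) (l : ℕ) :
    inner ℝ (branchVec G d r k u x) (depthVec r u l) = 0 := by
  refine inner_eq_zero_of_disjoint fun ⟨w, j⟩ h1 h2 => ?_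
  obtain ⟨p, hp, hup, hpl⟩ := exists_isPath_of_branchVec_apply_ne_zero hu hk hx h1
  obtain ⟨rfl, -⟩ := depthVec_apply_ne_zero h2
  exact hup p.end_mem_support

theorem inner_branchVec_of_ne_length (hu : G.UniqueShortPaths r) {k l : ℕ} (hk : k ≤ r)
    (hl : l ≤ r) {v u : V} (h : G.Adj v u) (hkl : k ≠ l) :
    inner ℝ (branchVec G d r k v u) (branchVec G d r l v u) = 0 := by
  refine inner_eq_zero_of_disjoint fun ⟨w, j⟩ h1 h2 => hkl ?_
  obtain ⟨p, hp, hup, hpl⟩ := exists_isPath_of_branchVec_apply_ne_zero hu hk h h1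
  obtain ⟨q, hq, huq, hql⟩ := exists_isPath_of_branchVec_apply_ne_zero hu hl h h2
  have heq := hu hp hq (by omega)
  rw [← hpl, ← hql, heq]

theorem inner_branchVec_swap (hu : G.UniqueShortPaths r) {k l : ℕ} (hk : k ≤ r)
    (hl : l ≤ r) {v u : V} (h : G.Adj v u) :
    inner ℝ (branchVec G d r k v u) (branchVec G d r l u v) = 0 := by
  refine inner_eq_zero_of_disjoint fun ⟨w, j⟩ h1 h2 => ?_
  obtain ⟨p, hp, hvp, hpl⟩ := exists_isPath_of_branchVec_apply_ne_zero hu hk h h1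
  obtain ⟨q, hq, huq, hql⟩ := exists_isPath_of_branchVec_apply_ne_zero hu hl h.symm h2
  have heq := hu (hp.cons (h := h) hvp) hq (by simp; omega)
  exact huq (by rw [← heq]; simp)

theorem inner_branchVec_self (hu : G.UniqueShortPaths r) (hd : 1 ≤ d)
    (hdeg : ∀ v : V, (G.neighborSet v).ncard ≤ d) {k : ℕ} (hk : k ≤ r) {v u : V}
    (h : G.Adj v u) :
    inner ℝ (branchVec G d r k v u) (branchVec G d r k v u) = ((d : ℝ) - 1) ^ k := by
  classical
  induction k generalizing v u with
  | zero => simpa [branchVec] using inner_depthVec_self u (Nat.succ_pos r)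
  | succ k ih =>
    have hd1 : (0 : ℝ) ≤ (d : ℝ) - 1 := by
      have : (1 : ℝ) ≤ d := by exact_mod_cast hd
      linarith
    have hdu : (0 : ℝ) ≤ (d : ℝ) - G.degree u := by
      have h1 := hdeg u
      rw [Set.ncard_eq_toFinset_card', Set.toFinset_card, card_neighborSet_eq_degree] at h1
      have : (G.degree u : ℝ) ≤ d := by exact_mod_cast h1
      linarith
    have hv : v ∈ G.neighborFinset u := by simpa using h.symm
    have hk' : k ≤ r := by omega
    rw [branchVec, inner_add_left, inner_add_right, inner_add_right, inner_smul_left,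
      inner_smul_right, inner_smul_right, inner_smul_left, sum_inner, inner_sum,
      inner_depthVec_self u (by omega)]
    have hz1 : ∑ x ∈ (G.neighborFinset u).erase v,
        inner ℝ (branchVec G d r k u x) (depthVec r u (k + 1)) = 0 :=
      Finset.sum_eq_zero fun x hx => inner_branchVec_depthVec hu hk'
        (by simpa using Finset.mem_of_mem_erase hx) _
    have hz2 : ∑ x ∈ (G.neighborFinset u).erase v,
        inner ℝ (depthVec r u (k + 1)) (branchVec G d r k u x) = 0 := by
      rw [← hz1]
      exact Finset.sum_congr rfl fun x _ => real_inner_comm _ _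
    have hz3 : ∑ x ∈ (G.neighborFinset u).erase v, inner ℝ (branchVec G d r k u x)
        (∑ y ∈ (G.neighborFinset u).erase v, branchVec G d r k u y) =
        ((G.degree u : ℝ) - 1) * ((d : ℝ) - 1) ^ k := by
      have : ∀ x ∈ (G.neighborFinset u).erase v, inner ℝ (branchVec G d r k u x)
          (∑ y ∈ (G.neighborFinset u).erase v, branchVec G d r k u y) = ((d : ℝ) - 1) ^ k := by
        intro x hx
        have hx' : G.Adj u x := by simpa using Finset.mem_of_mem_erase hx
        rw [inner_sum, Finset.sum_eq_single_of_mem x hx, ih hk' hx']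
        exact fun y hy hyx => inner_branchVec_of_ne_child hu hk' hx'
          (by simpa using Finset.mem_of_mem_erase hy) hyx.symm
      rw [Finset.sum_congr rfl this, Finset.sum_const, nsmul_eq_mul,
        Finset.cast_card_erase_of_mem hv, card_neighborFinset_eq_degree]
    rw [hz3, sum_inner, hz1, hz2, conj_trivial, mul_zero, mul_one, add_zero, zero_add,
      Real.mul_self_sqrt (by positivity)]
    ring

theorem inner_sum_branchVec (hu : G.UniqueShortPaths r) (hd : 1 ≤ d)
    (hdeg : ∀ v : V, (G.neighborSet v).ncard ≤ d) {v u : V} (h : G.Adj v u) (a b : ℕ → ℝ) :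
    inner ℝ (∑ k ∈ Finset.range (r + 1), a k • branchVec G d r k v u)
      (∑ k ∈ Finset.range (r + 1), b k • branchVec G d r k v u) =
    ∑ k ∈ Finset.range (r + 1), a k * b k * ((d : ℝ) - 1) ^ k := by
  rw [sum_inner]
  refine Finset.sum_congr rfl fun k hk => ?_
  have hkr := Finset.mem_range_succ_iff.mp hk
  rw [inner_smul_left, inner_sum, Finset.sum_eq_single_of_mem k hk, inner_smul_right,
    inner_branchVec_self hu hd hdeg hkr h, conj_trivial, mul_assoc]
  intro l hl hlk
  rw [inner_smul_right, inner_branchVec_of_ne_length hu hkr (Finset.mem_range_succ_iff.mp hl) h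
    hlk.symm, mul_zero]

theorem inner_sum_branchVec_swap (hu : G.UniqueShortPaths r) {v u : V} (h : G.Adj v u)
    (a b : ℕ → ℝ) :
    inner ℝ (∑ k ∈ Finset.range (r + 1), a k • branchVec G d r k v u)
      (∑ k ∈ Finset.range (r + 1), b k • branchVec G d r k u v) = 0 := by
  rw [sum_inner]
  refine Finset.sum_eq_zero fun k hk => ?_
  rw [inner_sum]
  refine Finset.sum_eq_zero fun l hl => ?_
  rw [inner_smul_left, inner_smul_right, inner_branchVec_swap hu
    (Finset.mem_range_succ_iff.mp hk) (Finset.mem_range_succ_iff.mp hl) h, mul_zero, mul_zero]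

variable (G d r) in
/-- The coefficient vector of the radial Gaussian wave at `u`. -/
noncomputable def waveVec (a : ℕ → ℝ) (u : V) : EuclideanSpace ℝ (V × Fin (r + 1)) :=
  ∑ k ∈ Finset.range (r + 1), a k • sphereVec G d r k u

theorem waveVec_eq_add {a : ℕ → ℝ} (ha : a (r + 1) = 0) {u v : V} (h : G.Adj u v) :
    waveVec G d r a u = ∑ k ∈ Finset.range (r + 1), a k • branchVec G d r k v u +
      ∑ k ∈ Finset.range (r + 1), a (k + 1) • branchVec G d r k u v := by
  rw [waveVec, Finset.sum_range_succ', Finset.sum_range_succ' (fun k => a k • branchVec G d r k v u),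
    Finset.sum_range_succ (fun k => a (k + 1) • branchVec G d r k u v), ha, zero_smul, add_zero]
  simp_rw [sphereVec_succ h, smul_add]
  rw [Finset.sum_add_distrib]
  simp only [sphereVec, branchVec]
  abel

theorem inner_waveVec_self (hu : G.UniqueShortPaths r) (hd : 1 ≤ d)
    (hdeg : ∀ v : V, (G.neighborSet v).ncard ≤ d) {a : ℕ → ℝ} (ha : a (r + 1) = 0) {u v : V}
    (h : G.Adj u v) :
    inner ℝ (waveVec G d r a u) (waveVec G d r a u) =
      ∑ k ∈ Finset.range (r + 1), a k * a k * ((d : ℝ) - 1) ^ k +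
      ∑ k ∈ Finset.range (r + 1), a (k + 1) * a (k + 1) * ((d : ℝ) - 1) ^ k := by
  rw [waveVec_eq_add ha h, inner_add_left, inner_add_right, inner_add_right,
    inner_sum_branchVec hu hd hdeg h.symm a a,
    inner_sum_branchVec_swap hu h.symm,
    inner_sum_branchVec_swap hu h,
    inner_sum_branchVec hu hd hdeg h (fun k => a (k + 1)) (fun k => a (k + 1))]
  ring

theorem inner_waveVec_of_adj (hu : G.UniqueShortPaths r) (hd : 1 ≤ d)
    (hdeg : ∀ v : V, (G.neighborSet v).ncard ≤ d) {a : ℕ → ℝ} (ha : a (r + 1) = 0) {u v : V}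
    (h : G.Adj u v) :
    inner ℝ (waveVec G d r a u) (waveVec G d r a v) =
      2 * ∑ k ∈ Finset.range (r + 1), a k * a (k + 1) * ((d : ℝ) - 1) ^ k := by
  rw [waveVec_eq_add ha h, waveVec_eq_add ha h.symm, inner_add_left, inner_add_right,
    inner_add_right,
    inner_sum_branchVec hu hd hdeg h.symm a (fun k => a (k + 1)),
    inner_sum_branchVec_swap hu h.symm,
    inner_sum_branchVec_swap hu h,
    inner_sum_branchVec hu hd hdeg h (fun k => a (k + 1)) a]
  simp only [mul_comm (a (_ + 1)) (a _)]
  ring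

theorem exists_vectors_of_uniqueShortPaths (hu : G.UniqueShortPaths r) (hd : 3 ≤ d)
    (hdeg : ∀ v : V, (G.neighborSet v).ncard ≤ d) :
    ∃ X : V → EuclideanSpace ℝ (V × Fin (r + 1)), ∀ u v, G.Adj u v →
      inner ℝ (X u) (X u) = r + 1 + r / ((d : ℝ) - 1) ∧
      inner ℝ (X u) (X v) = -(2 * r / √((d : ℝ) - 1)) := by
  have hd1 : (0 : ℝ) < (d : ℝ) - 1 := by
    have : (3 : ℝ) ≤ d := by exact_mod_cast hd
    linarith
  have hs : √((d : ℝ) - 1) ≠ 0 := (Real.sqrt_pos.mpr hd1).ne'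
  have hss : √((d : ℝ) - 1) ^ 2 = (d : ℝ) - 1 := Real.sq_sqrt hd1.le
  let a : ℕ → ℝ := fun k => if k < r + 1 then (-(√((d : ℝ) - 1))⁻¹) ^ k else 0
  have hlt (k : ℕ) (hk : k ∈ Finset.range (r + 1)) : a k = (-(√((d : ℝ) - 1))⁻¹) ^ k :=
    if_pos (Finset.mem_range.mp hk)
  have hlt' (k : ℕ) (hk : k ∈ Finset.range r) : a (k + 1) = (-(√((d : ℝ) - 1))⁻¹) ^ (k + 1) :=
    hlt _ (by simpa using hk)
  have ha : a (r + 1) = 0 := if_neg (lt_irrefl _)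
  have hpow (k : ℕ) : (-(√((d : ℝ) - 1))⁻¹) ^ k * (-(√((d : ℝ) - 1))⁻¹) ^ k *
      ((d : ℝ) - 1) ^ k = 1 := by
    rw [← mul_pow, ← mul_pow]
    have : -(√((d : ℝ) - 1))⁻¹ * -(√((d : ℝ) - 1))⁻¹ * ((d : ℝ) - 1) = 1 := by
      rw [neg_mul_neg, ← sq, inv_pow, hss, inv_mul_cancel₀ hd1.ne']
    rw [this, one_pow]
  refine ⟨waveVec G d r a, fun u v h => ⟨?_, ?_⟩⟩
  · rw [inner_waveVec_self hu (by omega) hdeg ha h, Finset.sum_range_succ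
      (fun k => a (k + 1) * a (k + 1) * ((d : ℝ) - 1) ^ k), ha]
    have h1 : ∀ k ∈ Finset.range (r + 1), a k * a k * ((d : ℝ) - 1) ^ k = 1 := fun k hk => by
      rw [hlt k hk, hpow]
    have h2 : ∀ k ∈ Finset.range r, a (k + 1) * a (k + 1) * ((d : ℝ) - 1) ^ k =
        ((d : ℝ) - 1)⁻¹ := fun k hk => by
      rw [hlt' k hk]
      refine eq_inv_of_mul_eq_one_left ?_
      rw [mul_assoc, ← pow_succ, hpow]
    rw [Finset.sum_congr rfl h1, Finset.sum_congr rfl h2]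
    simp [div_eq_mul_inv]
  · rw [inner_waveVec_of_adj hu (by omega) hdeg ha h, Finset.sum_range_succ, ha]
    have h2 : ∀ k ∈ Finset.range r, a k * a (k + 1) * ((d : ℝ) - 1) ^ k =
        -(√((d : ℝ) - 1))⁻¹ := fun k hk => by
      rw [hlt' k hk, hlt k (Finset.mem_range.mpr ((Finset.mem_range.mp hk).trans r.lt_succ_self)),
        pow_succ]
      linear_combination (-(√((d : ℝ) - 1))⁻¹) * hpow k
    rw [Finset.sum_congr rfl h2]
    simp
    ring

end

end SimpleGraph


/-- If `G` is a finite graph of maximum degree at most `d` and girth at least `2n+1`,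
then there is a set `S` of vertices whose edge cut contains at least a fraction
`(1/π) arccos(-(2√(d-1)/d)/(1 + (d-1)/(d(n-1))))` of all edges. -/
theorem exists_large_edge_cut {V : Type*} [Fintype V]
    (d n : ℕ) (hd : 3 ≤ d) (hn : 2 ≤ n)
    (G : SimpleGraph V) (hdeg : ∀ v : V, (G.neighborSet v).ncard ≤ d)
    (hgirth : (2 * n + 1 : ℕ∞) ≤ G.egirth) :
    ∃ S : Set V,
      (1 / π) * Real.arccos
          (-(2 * Real.sqrt ((d : ℝ) - 1) / (d : ℝ)) /
            (1 + ((d : ℝ) - 1) / ((d : ℝ) * ((n : ℝ) - 1))))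
        * (G.edgeSet.ncard : ℝ)
      ≤ ({e ∈ G.edgeSet | ∃ u v : V, e = s(u, v) ∧ u ∈ S ∧ v ∉ S}.ncard : ℝ) := by
  classical
  obtain ⟨r, rfl⟩ : ∃ r, n = r + 1 := ⟨n - 1, by omega⟩
  have hr : (1 : ℝ) ≤ r := by exact_mod_cast (by omega : 1 ≤ r)
  have hd3 : (3 : ℝ) ≤ d := by exact_mod_cast hd
  have hu : G.UniqueShortPaths r := fun u w p q hp hq h =>
    SimpleGraph.eq_of_isPath_of_length_add_length_lt_egirth hp hq <| lt_of_lt_of_le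
      (by exact_mod_cast (by omega : p.length + q.length < 2 * (r + 1) + 1)) hgirth
  obtain ⟨X, hX⟩ := SimpleGraph.exists_vectors_of_uniqueShortPaths hu hd hdeg
  have hd1 : (0 : ℝ) < (d : ℝ) - 1 := by linarith
  set q := √((d : ℝ) - 1) with hq
  have hq0 : 0 < q := Real.sqrt_pos.mpr hd1
  have hqq : q ^ 2 = (d : ℝ) - 1 := Real.sq_sqrt hd1.le
  have hnorm {u v : V} (h : G.Adj u v) : ‖X u‖ * ‖X v‖ = r + 1 + r / ((d : ℝ) - 1) := by
    rw [norm_eq_sqrt_real_inner, norm_eq_sqrt_real_inner, (hX u v h).1, (hX v u h.symm).1,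
      Real.mul_self_sqrt (by positivity)]
  have hρ : -(2 * q / d) / (1 + ((d : ℝ) - 1) / (d * (((r + 1 : ℕ) : ℝ) - 1))) =
      -(2 * r / q) / (r + 1 + r / ((d : ℝ) - 1)) := by
    rw [← hqq, (by linarith : (d : ℝ) = q ^ 2 + 1)]
    push_cast
    rw [add_sub_cancel_right]
    field_simp
    ring
  have hN : 0 < (r : ℝ) + 1 + r / ((d : ℝ) - 1) := by positivity
  have hlt1 : -(2 * r / q) / (r + 1 + r / ((d : ℝ) - 1)) < 1 :=
    (div_neg_of_neg_of_pos (neg_neg_of_pos (by positivity)) hN).trans one_pos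
  have hgt : -1 < -(2 * r / q) / (r + 1 + r / ((d : ℝ) - 1)) := by
    rw [lt_div_iff₀ hN, ← hqq]
    have : (r : ℝ) + 1 + r / q ^ 2 - 2 * r / q = r * (1 - 1 / q) ^ 2 + 1 := by
      field_simp
      ring
    have : 0 ≤ (r : ℝ) * (1 - 1 / q) ^ 2 := by positivity
    linarith
  have hπ : arccos (-(2 * r / q) / (r + 1 + r / ((d : ℝ) - 1))) < π :=
    arccos_neg_one ▸ arccos_lt_arccos le_rfl hgt hlt1.le
  rw [hρ, one_div_mul_eq_div]
  refine exists_edge_cut_of_angle G (arccos_pos.mpr hlt1) hπ X (fun u v h hz => ?_)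
    fun u v h => ?_
  · have h1 := (hX u v h).1
    rw [hz, inner_zero_left] at h1
    exact hN.ne h1
  · rw [InnerProductGeometry.angle, hnorm h, (hX u v h).2]
end

section
/- Let G be a simple graph on a finite vertex set V such that every vertex has degree at most 3 and the girth of G is at least 655. Then there exists a probability measure μ on the space of functions V → {0,1} (with all subsets measurable) such that for every edge {u,v} of G, μ({f : f(u) ≠ f(v)}) ≥ 0.89. -/
open MeasureTheory

section Gaussian

open ProbabilityTheory Real Set
open scoped ENNReal

lemma gaussianReal_prod_eq_withDensity :
    (gaussianReal 0 1).prod (gaussianReal 0 1) = (volume : Measure (ℝ × ℝ)).withDensity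
      (fun p ↦ ENNReal.ofReal ((2 * π)⁻¹ * rexp (-(p.1 ^ 2 + p.2 ^ 2) / 2))) := by
  rw [gaussianReal_of_var_ne_zero _ one_ne_zero,
    prod_withDensity (by fun_prop) (by fun_prop), ← Measure.volume_eq_prod]
  congr 1 with p
  rw [gaussianPDF, gaussianPDF, ← ENNReal.ofReal_mul (gaussianPDFReal_nonneg _ _ _)]
  congr 1
  have : (√(2 * π))⁻¹ * (√(2 * π))⁻¹ = (2 * π)⁻¹ := by
    rw [← mul_inv, mul_self_sqrt (by positivity)]
  simp only [gaussianPDFReal, NNReal.coe_one, mul_one, sub_zero]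
  rw [mul_mul_mul_comm, this, ← exp_add]
  ring_nf

/-- The radial part of the standard Gaussian measure on the plane. -/
lemma exists_le_gaussianReal_prod : ∃ K : ℝ≥0∞, K * ENNReal.ofReal (2 * π) = 1 ∧
    ∀ (I : Set ℝ) (S : Set (ℝ × ℝ)), MeasurableSet I → MeasurableSet S → I ⊆ Ioo (-π) π →
      (∀ r > 0, ∀ φ ∈ I, (r * cos φ, r * sin φ) ∈ S) →
      K * volume I ≤ (gaussianReal 0 1).prod (gaussianReal 0 1) S := by
  set g : ℝ → ℝ≥0∞ := fun r ↦ ENNReal.ofReal r * ENNReal.ofReal ((2 * π)⁻¹ * rexp (-r ^ 2 / 2))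
    with hg
  have hgm : Measurable g := by fun_prop
  have hsq (r φ : ℝ) : (r * cos φ) ^ 2 + (r * sin φ) ^ 2 = r ^ 2 := by
    linear_combination r ^ 2 * cos_sq_add_sin_sq φ
  have hprod (I : Set ℝ) : ∫⁻ p in Ioi (0 : ℝ) ×ˢ I, g p.1 = (∫⁻ r in Ioi 0, g r) * volume I := by
    rw [Measure.volume_eq_prod, ← Measure.prod_restrict, lintegral_prod _ (by fun_prop)]
    simp [lintegral_mul_const _ hgm]
  refine ⟨∫⁻ r in Ioi 0, g r, ?_, fun I S hI hS hIπ h ↦ ?_⟩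
  · have h1 : (gaussianReal 0 1).prod (gaussianReal 0 1) univ = 1 := measure_univ
    rw [gaussianReal_prod_eq_withDensity, withDensity_apply _ MeasurableSet.univ,
      Measure.restrict_univ, ← lintegral_comp_polarCoord_symm] at h1
    have h2 : volume (Ioo (-π) π) = ENNReal.ofReal (2 * π) := by
      rw [volume_Ioo]; ring_nf
    rw [← h1, ← h2, ← hprod]
    simp only [polarCoord_symm_apply, hsq, smul_eq_mul]
    rfl
  · rw [gaussianReal_prod_eq_withDensity, withDensity_apply _ hS, ← lintegral_indicator hS,
      ← lintegral_comp_polarCoord_symm, ← hprod]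
    calc ∫⁻ p in Ioi (0 : ℝ) ×ˢ I, g p.1
        = ∫⁻ p in Ioi (0 : ℝ) ×ˢ I, ENNReal.ofReal p.1 • S.indicator
          (fun p ↦ ENNReal.ofReal ((2 * π)⁻¹ * rexp (-(p.1 ^ 2 + p.2 ^ 2) / 2)))
            (polarCoord.symm p) := by
          refine setLIntegral_congr_fun (measurableSet_Ioi.prod hI) fun p hp ↦ ?_
          have : polarCoord.symm p ∈ S := by
            rw [polarCoord_symm_apply]
            exact h _ hp.1 _ hp.2
          simp only [indicator_of_mem this]
          simp only [polarCoord_symm_apply, hsq, smul_eq_mul, hg]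
      _ ≤ _ := lintegral_mono_set (prod_mono_right hIπ)

lemma ofReal_le_gaussianReal_prod_sign_ne {β : ℝ} (h1 : π / 2 ≤ β) (h2 : β ≤ π) :
    ENNReal.ofReal (β / π) ≤ (gaussianReal 0 1).prod (gaussianReal 0 1)
      {p : ℝ × ℝ | ¬ (0 ≤ p.1 ↔ 0 ≤ p.1 * cos β + p.2 * sin β)} := by
  have hπ := pi_pos
  obtain ⟨K, hK, hle⟩ := exists_le_gaussianReal_prod
  set I₁ := Ioo (-π) (β - 3 * π / 2)
  set I₂ := Ioo (-(π / 2)) (β - π / 2)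
  set I₃ := Ioo (π / 2) π
  have hvol : volume (I₁ ∪ I₂ ∪ I₃) = ENNReal.ofReal (2 * β) := by
    rw [measure_union _ measurableSet_Ioo, measure_union _ measurableSet_Ioo, volume_Ioo,
      volume_Ioo, volume_Ioo, ← ENNReal.ofReal_add, ← ENNReal.ofReal_add]
    · ring_nf
    all_goals first
      | linarith
      | (rw [Set.disjoint_left]
         rintro x hx hx'
         simp only [I₁, I₂, mem_union, mem_Ioo] at hx hx'
         grind)
  have hrot (r φ : ℝ) : r * cos φ * cos β + r * sin φ * sin β = r * cos (φ - β) := by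
    rw [cos_sub]; ring
  refine le_trans (le_of_eq ?_) (hle (I₁ ∪ I₂ ∪ I₃) _
    ((measurableSet_Ioo.union measurableSet_Ioo).union measurableSet_Ioo) ?_ ?_ ?_)
  · have : ENNReal.ofReal (2 * β) = ENNReal.ofReal (2 * π) * ENNReal.ofReal (β / π) := by
      rw [← ENNReal.ofReal_mul (by positivity)]
      congr 1
      field_simp
    rw [hvol, this, ← mul_assoc, hK, one_mul]
  · exact (measurableSet_le (by fun_prop) (by fun_prop)).iff
      (measurableSet_le (by fun_prop) (by fun_prop)) |>.compl
  · simp only [I₁, I₂, I₃, union_subset_iff]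
    refine ⟨⟨Ioo_subset_Ioo ?_ ?_, Ioo_subset_Ioo ?_ ?_⟩, Ioo_subset_Ioo ?_ ?_⟩ <;> linarith
  · intro r hr φ hφ
    simp only [mem_ofPred_eq, hrot, mul_nonneg_iff_of_pos_left hr]
    rcases hφ with (hφ | hφ) | hφ <;> obtain ⟨ha, hb⟩ := hφ
    · have hneg : cos φ < 0 := by
        rw [← cos_neg]
        exact cos_neg_of_pi_div_two_lt_of_lt (by linarith) (by linarith)
      have hpos : 0 ≤ cos (φ - β) := by
        rw [← cos_add_two_pi]
        exact cos_nonneg_of_neg_pi_div_two_le_of_le (by linarith) (by linarith)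
      grind
    · have hpos : 0 ≤ cos φ := cos_nonneg_of_neg_pi_div_two_le_of_le (by linarith) (by linarith)
      have hneg : cos (φ - β) < 0 := by
        rw [← cos_neg]
        exact cos_neg_of_pi_div_two_lt_of_lt (by linarith) (by linarith)
      grind
    · have hneg : cos φ < 0 := cos_neg_of_pi_div_two_lt_of_lt (by linarith) (by linarith)
      have hpos : 0 ≤ cos (φ - β) :=
        cos_nonneg_of_neg_pi_div_two_le_of_le (by linarith) (by linarith)
      grind

variable {E : Type*} [NormedAddCommGroup E] [InnerProductSpace ℝ E] [FiniteDimensional ℝ E]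
  [MeasurableSpace E] [BorelSpace E]

/-- The joint law of the inner products of a standard Gaussian vector with two fixed vectors. -/
lemma map_inner_stdGaussian (x y : E) :
    (stdGaussian E).map (fun g ↦ !₂[inner ℝ x g, inner ℝ y g]) =
      ((gaussianReal 0 1).prod (gaussianReal 0 1)).map (fun p ↦ !₂[‖x‖ * p.1,
        ‖y‖ * (p.1 * cos (InnerProductGeometry.angle x y) +
          p.2 * sin (InnerProductGeometry.angle x y))]) := by
  have hm1 : Measurable (fun g : E ↦ !₂[inner ℝ x g, inner ℝ y g]) := by fun_prop
  have hm2 : Measurable (fun p : ℝ × ℝ ↦ !₂[‖x‖ * p.1,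
        ‖y‖ * (p.1 * cos (InnerProductGeometry.angle x y) +
          p.2 * sin (InnerProductGeometry.angle x y))]) := by fun_prop
  have := Measure.isProbabilityMeasure_map (μ := stdGaussian E) hm1.aemeasurable
  have := Measure.isProbabilityMeasure_map (μ := (gaussianReal 0 1).prod (gaussianReal 0 1))
    hm2.aemeasurable
  refine Measure.ext_of_charFun ?_
  ext t
  set β := InnerProductGeometry.angle x y with hβ
  have hxy : ‖x‖ * ‖y‖ * cos β = inner ℝ x y := by
    rw [hβ, mul_comm]; exact InnerProductGeometry.cos_angle_mul_norm_mul_norm x y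
  have h1 : charFun ((stdGaussian E).map (fun g ↦ !₂[inner ℝ x g, inner ℝ y g])) t =
      charFun (stdGaussian E) (t 0 • x + t 1 • y) := by
    rw [charFun_apply, charFun_apply, integral_map hm1.aemeasurable (by fun_prop)]
    congr with g
    simp [PiLp.inner_apply, Fin.sum_univ_two, inner_add_right, inner_smul_right, real_inner_comm]
  have h2 : charFun (((gaussianReal 0 1).prod (gaussianReal 0 1)).map (fun p ↦ !₂[‖x‖ * p.1,
        ‖y‖ * (p.1 * cos β + p.2 * sin β)])) t =
      charFun (gaussianReal 0 1) (t 0 * ‖x‖ + t 1 * ‖y‖ * cos β) *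
        charFun (gaussianReal 0 1) (t 1 * ‖y‖ * sin β) := by
    rw [charFun_apply, charFun_apply, charFun_apply, integral_map hm2.aemeasurable (by fun_prop),
      ← integral_prod_mul]
    congr with p
    rw [← Complex.exp_add]
    simp [PiLp.inner_apply, Fin.sum_univ_two]
    ring_nf
  rw [h1, h2, charFun_stdGaussian, charFun_gaussianReal, charFun_gaussianReal, ← Complex.exp_add]
  congr 1
  have hn : ‖t 0 • x + t 1 • y‖ ^ 2 =
      (t 0 * ‖x‖ + t 1 * ‖y‖ * cos β) ^ 2 + (t 1 * ‖y‖ * sin β) ^ 2 := by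
    rw [norm_add_sq_real, norm_smul, norm_smul, inner_smul_left, inner_smul_right, ← hxy, mul_pow,
      mul_pow, norm_eq_abs, norm_eq_abs, sq_abs, sq_abs]
    simp only [conj_trivial]
    linear_combination -(t 1 * ‖y‖) ^ 2 * sin_sq_add_cos_sq β
  rw [← Complex.ofReal_pow, hn]
  push_cast
  ring

/-- A random hyperplane separates two vectors at an obtuse angle `β` with probability at least
`β / π`. -/
lemma ofReal_angle_div_pi_le_stdGaussian {x y : E} (hx : x ≠ 0) (hy : y ≠ 0)
    (h : π / 2 ≤ InnerProductGeometry.angle x y) :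
    ENNReal.ofReal (InnerProductGeometry.angle x y / π) ≤
      stdGaussian E {g | ¬ (0 ≤ inner ℝ x g ↔ 0 ≤ inner ℝ y g)} := by
  set S : Set (EuclideanSpace ℝ (Fin 2)) := {z | ¬ (0 ≤ z 0 ↔ 0 ≤ z 1)}
  have hS : MeasurableSet S :=
    (measurableSet_le (by fun_prop) (by fun_prop)).iff
      (measurableSet_le (by fun_prop) (by fun_prop)) |>.compl
  have hmap := congrArg (fun μ ↦ μ S) (map_inner_stdGaussian x y)
  rw [Measure.map_apply (by fun_prop) hS, Measure.map_apply (by fun_prop) hS] at hmap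
  refine (ofReal_le_gaussianReal_prod_sign_ne h (InnerProductGeometry.angle_le_pi x y)).trans
    (le_of_eq (Eq.trans ?_ hmap.symm))
  congr 1
  ext p
  simp [S, mul_nonneg_iff_of_pos_left, norm_pos_iff.2 hx, norm_pos_iff.2 hy]

lemma cos_eleven_hundredths_pi_le : cos (0.11 * π) ≤ 0.940883 := by
  have h1 := pi_gt_d6
  have h2 := pi_lt_d6
  have h3 : (0.055 * π) ^ 3 ≤ (0.055 * 3.141593) ^ 3 := by gcongr
  have h4 : 0.171927 ≤ sin (0.055 * π) := by
    have := sin_ge_sub_cube (x := 0.055 * π) (by positivity)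
    norm_num at *
    linarith
  have h5 : cos (0.11 * π) = 1 - 2 * sin (0.055 * π) ^ 2 := by
    rw [← cos_two_mul_eq_one_sub]
    ring_nf
  nlinarith

end Gaussian

namespace SimpleGraph

variable {V : Type*} {G : SimpleGraph V}

/-- Two paths with the same ends coincide if their total length is less than the girth. -/
lemma Walk.IsPath.eq_of_length_add_length_lt_egirth {a b : V} {p q : G.Walk a b} (hp : p.IsPath)
    (hq : q.IsPath) (h : ((p.length + q.length : ℕ) : ℕ∞) < G.egirth) : p = q := by
  classical
  set H : SimpleGraph V := fromEdgeSet {e | e ∈ p.edges ++ q.edges} with hH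
  have hHG : H ≤ G := by
    intro x y hxy
    have hxy' : s(x, y) ∈ p.edges ++ q.edges := ((fromEdgeSet_adj _).1 hxy).1
    rcases List.mem_append.1 hxy' with h' | h'
    exacts [p.adj_of_mem_edges h', q.adj_of_mem_edges h']
  have hsub : ∀ e ∈ H.edgeSet, e ∈ p.edges ++ q.edges := by
    intro e he
    rw [hH, edgeSet_fromEdgeSet] at he
    exact he.1
  have hacyc : H.IsAcyclic := by
    intro x c hc
    refine absurd (egirth_le_length (hc.mapLe hHG)) (not_le.2 (lt_of_le_of_lt ?_ h))
    rw [Walk.length_map, Nat.cast_le, ← c.length_edges, ← p.length_edges, ← q.length_edges,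
      ← List.length_append, ← List.toFinset_card_of_nodup hc.isTrail.edges_nodup]
    refine (Finset.card_le_card fun e he ↦ ?_).trans (List.toFinset_card_le _)
    rw [List.mem_toFinset] at he ⊢
    exact hsub e (c.edges_subset_edgeSet he)
  have hpH : ∀ e ∈ p.edges, e ∈ H.edgeSet := fun e he ↦ by
    rw [hH, edgeSet_fromEdgeSet]
    exact ⟨List.mem_append_left _ he, G.not_isDiag_of_mem_edgeSet (p.edges_subset_edgeSet he)⟩
  have hqH : ∀ e ∈ q.edges, e ∈ H.edgeSet := fun e he ↦ by
    rw [hH, edgeSet_fromEdgeSet]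
    exact ⟨List.mem_append_right _ he, G.not_isDiag_of_mem_edgeSet (q.edges_subset_edgeSet he)⟩
  have := hacyc.subsingleton_path a b
  have key := congrArg Subtype.val (Subsingleton.elim (α := H.Path a b)
    ⟨p.transfer H hpH, hp.transfer hpH⟩ ⟨q.transfer H hqH, hq.transfer hqH⟩)
  have key' := congrArg Walk.support key
  simp only [Walk.support_transfer] at key'
  exact Walk.ext_support key'

lemma exists_isPath_of_edist_eq_coe {a b : V} {k : ℕ} (h : G.edist a b = k) :
    ∃ p : G.Walk a b, p.IsPath ∧ p.length = k := by
  obtain ⟨p, hp⟩ := exists_walk_of_edist_eq_coe h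
  refine ⟨p, p.isPath_of_length_eq_dist ?_, hp⟩
  rw [hp, dist, h, ENat.toNat_natCast]

lemma Adj.edist_le_edist_add_one {u v : V} (h : G.Adj u v) (a : V) :
    G.edist a v ≤ G.edist a u + 1 :=
  SimpleGraph.edist_triangle.trans (by rw [edist_eq_one_iff_adj.2 h])

lemma Adj.exists_isPath_concat {a u v : V} {k : ℕ} (h : G.Adj u v) (hu : G.edist a u = k)
    (hv : (k : ℕ∞) ≤ G.edist a v) :
    ∃ p : G.Walk a u, (p.concat h).IsPath ∧ (p.concat h).length = k + 1 := by
  classical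
  obtain ⟨p, hp, hl⟩ := exists_isPath_of_edist_eq_coe hu
  refine ⟨p, hp.concat (fun hmem ↦ ?_) h, by simp [hl]⟩
  have h1 := p.length_takeUntil_lt_length hmem h.ne'
  have h2 := hv.trans (edist_le (p.takeUntil v hmem))
  rw [Nat.cast_le] at h2
  omega

lemma Adj.edist_ne {a u v : V} {k : ℕ} (h : G.Adj u v) (hk : ((2 * k + 1 : ℕ) : ℕ∞) < G.egirth)
    (hu : G.edist a u = k) : G.edist a v ≠ k := by
  intro hv
  obtain ⟨p, hp, hl⟩ := h.exists_isPath_concat hu hv.ge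
  obtain ⟨q, hq, hl'⟩ := exists_isPath_of_edist_eq_coe hv
  have := congrArg Walk.length (hp.eq_of_length_add_length_lt_egirth hq
    (by convert hk using 2; omega))
  omega

lemma eq_of_adj_of_edist_eq {a w x y : V} {k : ℕ} (hx : G.Adj x w) (hy : G.Adj y w)
    (hk : ((2 * k + 2 : ℕ) : ℕ∞) < G.egirth) (hax : G.edist a x = k) (hay : G.edist a y = k)
    (haw : (k : ℕ∞) ≤ G.edist a w) : x = y := by
  obtain ⟨p, hp, hl⟩ := hx.exists_isPath_concat hax haw
  obtain ⟨q, hq, hl'⟩ := hy.exists_isPath_concat hay haw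
  have := hp.eq_of_length_add_length_lt_egirth hq (by convert hk using 2; omega)
  exact (Walk.concat_inj this).1

/-- A vertex at positive distance has a neighbour closer by one. -/
lemma exists_adj_edist_eq {a w : V} {k : ℕ} (h : G.edist a w = (k + 1 : ℕ)) :
    ∃ x, G.Adj x w ∧ G.edist a x = k := by
  obtain ⟨p, hp⟩ := exists_walk_of_edist_eq_coe h
  obtain ⟨x, q, hxw, rfl⟩ : ∃ (x : V) (q : G.Walk a x) (hx : G.Adj x w), p = q.concat hx := by
    cases p with
    | nil => simp at hp
    | cons h' p' => exact Walk.exists_cons_eq_concat h' p'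
  refine ⟨x, hxw, le_antisymm ?_ ?_⟩
  · refine (edist_le q).trans ?_
    rw [Walk.length_concat] at hp
    exact_mod_cast (by omega : q.length ≤ k)
  · have := hxw.edist_le_edist_add_one a
    rw [h] at this
    push_cast at this
    exact (ENat.add_le_add_iff_right (by simp)).1 this

lemma Adj.exists_edist_eq_coe {a x y : V} {i : ℕ} (h : G.Adj x y) (hx : G.edist a x = i) :
    ∃ j : ℕ, G.edist a y = j ∧ j ≤ i + 1 ∧ i ≤ j + 1 := by
  have h1 := h.edist_le_edist_add_one a
  have h2 := h.symm.edist_le_edist_add_one a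
  rw [hx] at h1 h2
  obtain ⟨j, hj⟩ := ENat.ne_top_iff_exists.1 (ne_top_of_le_ne_top (by simp) h1)
  rw [← hj] at h1 h2
  exact ⟨j, hj.symm, by exact_mod_cast h1, by exact_mod_cast h2⟩

/-- If the geodesic from `v` to `w` starts with the edge from `v` to `u`, then every neighbour of
`w` but the one towards `u` (or `v`, if `w = u`) is farther by one from both `u` and `v`. -/
lemma edist_eq_of_adj_of_edist_eq {u v w x : V} {k : ℕ} (huv : G.Adj u v) (hwx : G.Adj w x)
    (hk : ((2 * k + 3 : ℕ) : ℕ∞) < G.egirth) (hu : G.edist u w = k)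
    (hv : G.edist v w = (k + 1 : ℕ))
    (hx : ¬ (G.edist u x = (k + 1 : ℕ) ∧ G.edist v x = (k + 1 + 1 : ℕ))) :
    (k = 0 ∧ x = v) ∨ (1 ≤ k ∧ G.edist u x = (k - 1 : ℕ)) := by
  have hlt {l : ℕ} (hl : l ≤ 2 * k + 3) : (l : ℕ∞) < G.egirth :=
    lt_of_le_of_lt (by exact_mod_cast hl) hk
  obtain ⟨j, hj, hj1, hj2⟩ := hwx.exists_edist_eq_coe hu
  obtain ⟨i, hi, hi1, hi2⟩ := hwx.exists_edist_eq_coe hv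
  have hjk : j ≠ k := by
    rintro rfl
    exact hwx.edist_ne (hlt (by omega)) hu hj
  have hik : i ≠ k + 1 := by
    rintro rfl
    exact hwx.edist_ne (hlt (by omega)) hv hi
  obtain rfl | hj' : j = k + 1 ∨ j + 1 = k := by omega
  · have hik' : i ≠ k + 1 + 1 := by
      rintro rfl
      exact hx ⟨hj, hi⟩
    obtain rfl : i = k := by omega
    cases i with
    | zero =>
      left
      rw [Nat.cast_zero, edist_eq_zero_iff] at hi
      exact ⟨rfl, hi.symm⟩
    | succ l =>
      exfalso
      rw [SimpleGraph.edist_comm] at hu hv hi hj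
      obtain ⟨y, hyu, hy⟩ := exists_adj_edist_eq hu
      have hxy : G.edist x y = (l + 1 : ℕ) := by
        rw [SimpleGraph.edist_comm] at hy ⊢
        obtain ⟨i', hi', h1, -⟩ := hwx.exists_edist_eq_coe hy
        rw [SimpleGraph.edist_comm] at hi'
        obtain ⟨j', hj', -, h2⟩ := hyu.symm.exists_edist_eq_coe hj
        rw [hi', Nat.cast_inj] at hj'
        rw [SimpleGraph.edist_comm, hi', Nat.cast_inj]
        omega
      obtain rfl := eq_of_adj_of_edist_eq hyu huv.symm (hlt (by omega)) hxy hi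
        (by rw [hj]; exact_mod_cast Nat.le_succ _)
      rw [hy, Nat.cast_inj] at hv
      omega
  · right
    refine ⟨by omega, ?_⟩
    rw [hj, Nat.cast_inj]
    omega

section Counting

variable [Fintype V] [DecidableRel G.Adj]

open Finset

open scoped Classical in
lemma card_sphere_le_degree (v : V) :
    #{w | G.edist v w = 1} ≤ G.degree v := by
  rw [← card_neighborFinset_eq_degree]
  refine card_le_card fun w ↦ ?_
  simp

open scoped Classical in
lemma card_sphere_add_card_sphere_le_sum_degree (v : V) {k : ℕ} (hk : 1 ≤ k) :
    #{w | G.edist v w = k} + #{w | G.edist v w = (k + 1 : ℕ)} ≤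
      ∑ w with G.edist v w = k, G.degree w := by
  set S : Finset V := {w | G.edist v w = k}
  set S' : Finset V := {w | G.edist v w = (k + 1 : ℕ)}
  have h1 : #S' ≤ ∑ w ∈ S, #(bipartiteAbove G.Adj S' w) := by
    rw [sum_card_bipartiteAbove_eq_sum_card_bipartiteBelow, card_eq_sum_ones]
    refine sum_le_sum fun y hy ↦ card_pos.2 ?_
    obtain ⟨x, hxy, hx⟩ := exists_adj_edist_eq (mem_filter.1 hy).2
    exact ⟨x, by simp [bipartiteBelow, S, hx, hxy]⟩
  have h2 : ∀ w ∈ S, 1 + #(bipartiteAbove G.Adj S' w) ≤ G.degree w := by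
    intro w hw
    have hw' := (mem_filter.1 hw).2
    obtain ⟨l, rfl⟩ := Nat.exists_eq_add_of_le' hk
    obtain ⟨x, hxw, hx⟩ := exists_adj_edist_eq hw'
    have hxm : x ∉ bipartiteAbove G.Adj S' w := by
      simp only [bipartiteAbove, S', mem_filter, hx, Nat.cast_inj]
      omega
    rw [← card_neighborFinset_eq_degree, add_comm, ← card_insert_of_notMem hxm]
    refine card_le_card fun y hy ↦ ?_
    rw [mem_neighborFinset]
    rcases mem_insert.1 hy with rfl | hy
    exacts [hxw.symm, (mem_filter.1 hy).2]
  calc #S + #S' ≤ ∑ w ∈ S, 1 + ∑ w ∈ S, #(bipartiteAbove G.Adj S' w) := by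
        rw [← card_eq_sum_ones]; gcongr
    _ ≤ ∑ w ∈ S, G.degree w := by
        rw [← sum_add_distrib]
        exact sum_le_sum h2

open scoped Classical in
lemma Adj.sum_degree_le {u v : V} (huv : G.Adj u v) {k : ℕ}
    (hk : ((2 * k + 3 : ℕ) : ℕ∞) < G.egirth) :
    ∑ w with G.edist u w = k ∧ G.edist v w = (k + 1 : ℕ), G.degree w ≤
      #{w | G.edist u w = k ∧ G.edist v w = (k + 1 : ℕ)} +
        #{w | G.edist u w = (k + 1 : ℕ) ∧ G.edist v w = (k + 1 + 1 : ℕ)} := by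
  set S : Finset V := {w | G.edist u w = k ∧ G.edist v w = (k + 1 : ℕ)}
  set S' : Finset V := {w | G.edist u w = (k + 1 : ℕ) ∧ G.edist v w = (k + 1 + 1 : ℕ)}
  have hlt {l : ℕ} (hl : l ≤ 2 * k + 3) : (l : ℕ∞) < G.egirth :=
    lt_of_le_of_lt (by exact_mod_cast hl) hk
  have h1 : ∑ w ∈ S, #(bipartiteAbove G.Adj S' w) ≤ #S' := by
    rw [sum_card_bipartiteAbove_eq_sum_card_bipartiteBelow, card_eq_sum_ones]
    refine sum_le_sum fun y hy ↦ card_le_one.2 fun a ha b hb ↦ ?_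
    simp only [bipartiteBelow, S, S', mem_filter, mem_univ, true_and] at ha hb hy
    exact eq_of_adj_of_edist_eq ha.2 hb.2 (hlt (by omega)) ha.1.1 hb.1.1
      (by rw [hy.1]; exact_mod_cast Nat.le_succ _)
  have h2 : ∀ w ∈ S, G.degree w ≤ 1 + #(bipartiteAbove G.Adj S' w) := by
    intro w hw
    simp only [S, mem_filter, mem_univ, true_and] at hw
    have h3 : #(G.neighborFinset w \ S') ≤ 1 := by
      refine card_le_one.2 fun a ha b hb ↦ ?_
      simp only [S', mem_sdiff, mem_neighborFinset, mem_filter, mem_univ, true_and] at ha hb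
      rcases edist_eq_of_adj_of_edist_eq huv ha.1 hk hw.1 hw.2 ha.2 with ⟨h0, rfl⟩ | ⟨h0, ha'⟩ <;>
      rcases edist_eq_of_adj_of_edist_eq huv hb.1 hk hw.1 hw.2 hb.2 with ⟨h0', rfl⟩ | ⟨h0', hb'⟩
      · rfl
      · omega
      · omega
      · exact eq_of_adj_of_edist_eq ha.1.symm hb.1.symm (hlt (by omega)) ha' hb'
          (by rw [hw.1]; exact_mod_cast Nat.sub_le _ _)
    have h4 : G.neighborFinset w ∩ S' = bipartiteAbove G.Adj S' w := by
      ext y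
      simp [bipartiteAbove, and_comm]
    rw [← card_neighborFinset_eq_degree, ← card_sdiff_add_card_inter _ S', h4]
    gcongr
  calc ∑ w ∈ S, G.degree w ≤ ∑ w ∈ S, (1 + #(bipartiteAbove G.Adj S' w)) := sum_le_sum h2
    _ ≤ #S + #S' := by
        rw [sum_add_distrib, ← card_eq_sum_ones]; gcongr

end Counting

end SimpleGraph

lemma sum_sphere_le {s D : ℕ → ℝ} (m : ℕ) (h0 : s 0 = 1) (hD0 : s 1 ≤ D 0)
    (hD : ∀ k, 1 ≤ k → s k + s (k + 1) ≤ D k) :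
    ∑ k ∈ Finset.range (m + 1), (1 / 2 : ℝ) ^ k * (s k + (3 * s k - D k) * (m - k) / 2) ≤
      1 + 3 / 2 * m := by
  suffices h : ∀ n ≤ m, ∑ k ∈ Finset.range (n + 1),
      (1 / 2 : ℝ) ^ k * (s k + (3 * s k - D k) * (m - k) / 2) ≤
      1 + 3 / 2 * m - (1 / 2) ^ (n + 1) * s (n + 1) * (m - n) by
    simpa using h m le_rfl
  intro n
  induction n with
  | zero =>
    intro _
    simp only [zero_add, Finset.sum_range_one, pow_zero, h0, Nat.cast_zero, sub_zero, pow_one]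
    nlinarith [mul_le_mul_of_nonneg_right hD0 (Nat.cast_nonneg (α := ℝ) m)]
  | succ n ih =>
    intro hn
    rw [Finset.sum_range_succ]
    have hmn : (0 : ℝ) ≤ (1 / 2) ^ (n + 1) * (m - (n + 1 : ℕ)) :=
      mul_nonneg (by positivity) (sub_nonneg.2 (by exact_mod_cast hn))
    have := mul_le_mul_of_nonneg_left (hD (n + 1) (by omega)) hmn
    have := ih (by omega)
    push_cast at *
    rw [pow_succ _ (n + 1)]
    linarith

lemma le_sum_sphere {s D : ℕ → ℝ} (m : ℕ) (h0 : s 0 = 1)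
    (hD : ∀ k < m, D k ≤ s k + s (k + 1)) :
    m ≤ ∑ k ∈ Finset.range m, (1 / 2 : ℝ) ^ k * (s k + (3 * s k - D k) * (m - 1 - k) / 2) := by
  suffices h : ∀ n ≤ m, m - (1 / 2) ^ n * s n * (m - n) ≤ ∑ k ∈ Finset.range n,
      (1 / 2 : ℝ) ^ k * (s k + (3 * s k - D k) * (m - 1 - k) / 2) by
    simpa using h m le_rfl
  intro n
  induction n with
  | zero => simp [h0]
  | succ n ih =>
    intro hn
    rw [Finset.sum_range_succ]
    have hn' : ((n + 1 : ℕ) : ℝ) ≤ m := by exact_mod_cast hn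
    push_cast at hn' ⊢
    have hmn : (0 : ℝ) ≤ (1 / 2) ^ n * (m - 1 - n) :=
      mul_nonneg (by positivity) (by linarith)
    have := mul_le_mul_of_nonneg_left (hD n (by omega)) hmn
    have := ih (by omega)
    rw [pow_succ _ n]
    linarith

/-- The multiplicities of the levels of `δ` binary trees hanging from a common root. -/
def hangingWeight (δ : ℝ) : ℕ → ℝ
  | 0 => 1
  | j + 1 => δ * 2 ^ j

lemma hangingWeight_nonneg {δ : ℝ} (hδ : 0 ≤ δ) : ∀ j, 0 ≤ hangingWeight δ j
  | 0 => zero_le_one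
  | _ + 1 => by unfold hangingWeight; positivity

lemma sum_hangingWeight_mul (δ : ℝ) {m M : ℕ} (hM : M ≤ m) (k : ℕ) :
    ∑ j ∈ Finset.range (m + 1),
      hangingWeight δ j * (if k + j ≤ M then (1 / 2 : ℝ) ^ (k + j) else 0) =
      if k ≤ M then (1 / 2 : ℝ) ^ k * (1 + δ * (M - k) / 2) else 0 := by
  split_ifs with hk
  · obtain ⟨l, rfl⟩ := Nat.exists_eq_add_of_le hk
    have h : ∀ j ∈ Finset.range m,
        hangingWeight δ (j + 1) * (if k + (j + 1) ≤ k + l then (1 / 2 : ℝ) ^ (k + (j + 1)) else 0) =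
        if j ∈ Finset.range l then (1 / 2 : ℝ) ^ k * (δ / 2) else 0 := by
      intro j _
      simp only [hangingWeight, Finset.mem_range, Nat.add_le_add_iff_left, Nat.succ_le_iff]
      split_ifs
      · have : (2 : ℝ) ^ j * (1 / 2) ^ j = 1 := by rw [← mul_pow]; norm_num
        rw [pow_add, pow_succ]
        linear_combination δ * (1 / 2) ^ k * (1 / 2) * this
      · simp
    rw [Finset.sum_range_succ', Finset.sum_congr rfl h, Finset.sum_ite_mem,
      Finset.inter_eq_right.2 (Finset.range_mono (by omega)), Finset.sum_const]
    simp [hangingWeight]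
    ring
  · refine Finset.sum_eq_zero fun j _ ↦ ?_
    rw [if_neg (by omega), mul_zero]

/-- The alternating geometric sequence of ratio `-√(1 / 2)`, truncated after the index `m`. -/
noncomputable def truncatedGeom (m : ℕ) (e : ℕ∞) : ℝ :=
  if e ≤ m then (-√(1 / 2)) ^ e.toNat else 0

lemma truncatedGeom_top (m : ℕ) : truncatedGeom m ⊤ = 0 := by simp [truncatedGeom]

lemma truncatedGeom_natCast (m k : ℕ) :
    truncatedGeom m k = if k ≤ m then (-√(1 / 2)) ^ k else 0 := by
  simp only [truncatedGeom, Nat.cast_le, ENat.toNat_natCast]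

lemma truncatedGeom_mul_self (m k : ℕ) :
    truncatedGeom m k * truncatedGeom m k = if k ≤ m then (1 / 2) ^ k else 0 := by
  rw [truncatedGeom_natCast]
  split_ifs
  · rw [← mul_pow, neg_mul_neg, Real.mul_self_sqrt (by norm_num)]
  · simp

lemma truncatedGeom_mul_succ (M k : ℕ) :
    truncatedGeom (M + 1) k * truncatedGeom (M + 1) (k + 1 : ℕ) =
      -√(1 / 2) * if k ≤ M then (1 / 2) ^ k else 0 := by
  rw [truncatedGeom_natCast, truncatedGeom_natCast]
  simp only [Nat.add_le_add_iff_right]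
  by_cases h : k ≤ M
  · rw [if_pos h, if_pos h, if_pos (Nat.le_succ_of_le h), pow_succ, ← mul_assoc, ← mul_pow,
      neg_mul_neg, Real.mul_self_sqrt (by norm_num), mul_comm]
  · simp [h]

lemma sum_hangingWeight_mul_truncatedGeom_sq (δ : ℝ) (m : ℕ) (e : ℕ∞) :
    ∑ j ∈ Finset.range (m + 1),
      hangingWeight δ j * (truncatedGeom m (e + j) * truncatedGeom m (e + j)) =
      ∑ k ∈ Finset.range (m + 1), if e = k then (1 / 2 : ℝ) ^ k * (1 + δ * (m - k) / 2) else 0 := by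
  induction e with
  | top => simp [truncatedGeom_top]
  | coe k =>
    simp_rw [← Nat.cast_add, truncatedGeom_mul_self, sum_hangingWeight_mul δ le_rfl, Nat.cast_inj,
      Finset.sum_ite_eq, Finset.mem_range, Nat.lt_succ_iff]

lemma sum_hangingWeight_mul_truncatedGeom_succ (δ : ℝ) (M k : ℕ) :
    ∑ j ∈ Finset.range (M + 1 + 1), hangingWeight δ j *
      (truncatedGeom (M + 1) ((k : ℕ∞) + j) * truncatedGeom (M + 1) (((k + 1 : ℕ) : ℕ∞) + j)) =
      -√(1 / 2) * ∑ i ∈ Finset.range (M + 1),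
        if k = i then (1 / 2 : ℝ) ^ i * (1 + δ * (M - i) / 2) else 0 := by
  simp_rw [← Nat.cast_add, add_right_comm k 1, truncatedGeom_mul_succ]
  rw [Finset.sum_ite_eq]
  simp_rw [mul_left_comm _ (-√(1 / 2)), ← Finset.mul_sum,
    sum_hangingWeight_mul δ (Nat.le_succ M), Finset.mem_range, Nat.lt_succ_iff]

namespace SimpleGraph

variable {V : Type*} {G : SimpleGraph V}

lemma Adj.sum_hangingWeight_mul_truncatedGeom {u v : V} (huv : G.Adj u v) (w : V) (δ : ℝ) {M : ℕ}
    (hM : ((2 * M + 3 : ℕ) : ℕ∞) < G.egirth) :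
    ∑ j ∈ Finset.range (M + 1 + 1), hangingWeight δ j *
      (truncatedGeom (M + 1) (G.edist u w + j) * truncatedGeom (M + 1) (G.edist v w + j)) =
      -√(1 / 2) * (∑ k ∈ Finset.range (M + 1),
          (if G.edist u w = k ∧ G.edist v w = (k + 1 : ℕ) then
            (1 / 2 : ℝ) ^ k * (1 + δ * (M - k) / 2) else 0) +
        ∑ k ∈ Finset.range (M + 1),
          (if G.edist v w = k ∧ G.edist u w = (k + 1 : ℕ) then
            (1 / 2 : ℝ) ^ k * (1 + δ * (M - k) / 2) else 0)) := by
  rcases eq_or_ne (G.edist u w) ⊤ with hu | hu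
  · have h (x : ℕ) : ¬ (⊤ = (x : ℕ∞) + 1) := fun h ↦ by exact_mod_cast ENat.top_ne_natCast _ h
    simp [hu, truncatedGeom_top, h]
  obtain ⟨k, hk⟩ := ENat.ne_top_iff_exists.1 hu
  obtain ⟨i, hi, h1, h2⟩ := huv.exists_edist_eq_coe (a := w) (i := k)
    (by rw [hk, SimpleGraph.edist_comm])
  rw [SimpleGraph.edist_comm] at hi
  rw [← hk, hi]
  simp only [Nat.cast_inj]
  obtain rfl | rfl | rfl : i = k ∨ i = k + 1 ∨ k = i + 1 := by omega
  · have hiM : M + 1 < i := by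
      by_contra! hle
      refine huv.edist_ne (a := w) (k := i) (lt_of_le_of_lt (by exact_mod_cast (by omega)) hM) ?_ ?_
      · rw [SimpleGraph.edist_comm, hk]
      · rw [SimpleGraph.edist_comm, hi]
    have h3 (x : ℕ) : ¬ (i = x ∧ i = x + 1) := by omega
    have h4 (x : ℕ) : ¬ (i + x ≤ M + 1) := by omega
    simp [h3, ← Nat.cast_add, truncatedGeom_natCast, h4]
  · have h3 (x : ℕ) : ¬ (k + 1 = x ∧ k = x + 1) := by omega
    have h4 (x : ℕ) : (k = x ∧ k + 1 = x + 1) ↔ k = x := by omega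
    rw [sum_hangingWeight_mul_truncatedGeom_succ]
    simp only [h3, h4, if_false, Finset.sum_const_zero, add_zero]
  · have h3 (x : ℕ) : ¬ (i + 1 = x ∧ i = x + 1) := by omega
    have h4 (x : ℕ) : (i = x ∧ i + 1 = x + 1) ↔ i = x := by omega
    simp_rw [mul_comm (truncatedGeom _ ((i + 1 : ℕ) + _))]
    rw [sum_hangingWeight_mul_truncatedGeom_succ]
    simp only [h3, h4, if_false, Finset.sum_const_zero, zero_add]

section Embedding

variable [Fintype V] [DecidableRel G.Adj]

open Finset

variable (G) in
/-- The vector attached to `v`: a truncated radial function on the ball around `v`, where trees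
are hung from the vertices of degree less than `3` to make the graph cubic. -/
noncomputable def radialVector (m : ℕ) (v : V) : EuclideanSpace ℝ (V × Fin (m + 1)) :=
  WithLp.toLp 2 fun p ↦
    √(hangingWeight (3 - G.degree p.1) p.2) * truncatedGeom m (G.edist v p.1 + (p.2 : ℕ))

lemma inner_radialVector (hdeg : ∀ v, G.degree v ≤ 3) (m : ℕ) (u v : V) :
    inner ℝ (G.radialVector m u) (G.radialVector m v) =
      ∑ w, ∑ j ∈ range (m + 1), hangingWeight (3 - G.degree w) j *
        (truncatedGeom m (G.edist u w + j) * truncatedGeom m (G.edist v w + j)) := by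
  rw [PiLp.inner_apply, Fintype.sum_prod_type]
  refine sum_congr rfl fun w _ ↦ ?_
  rw [← Fin.sum_univ_eq_sum_range (fun j ↦ hangingWeight (3 - G.degree w) j *
        (truncatedGeom m (G.edist u w + j) * truncatedGeom m (G.edist v w + j)))]
  refine sum_congr rfl fun j _ ↦ ?_
  have h : (0 : ℝ) ≤ 3 - G.degree w := sub_nonneg.2 (by exact_mod_cast hdeg w)
  have := Real.mul_self_sqrt (hangingWeight_nonneg h j)
  simp only [radialVector, RCLike.inner_apply, conj_trivial]
  linear_combination (truncatedGeom m (G.edist u w + (j : ℕ)) *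
    truncatedGeom m (G.edist v w + (j : ℕ))) * this

lemma norm_sq_radialVector_le (hdeg : ∀ v, G.degree v ≤ 3) (m : ℕ) (v : V) :
    ‖G.radialVector m v‖ ^ 2 ≤ 1 + 3 / 2 * m := by
  classical
  have h := sum_sphere_le (s := fun k ↦ #{w | G.edist v w = k})
    (D := fun k ↦ ∑ w with G.edist v w = k, (G.degree w : ℝ)) m ?_ ?_ ?_
  · refine le_trans (le_of_eq ?_) h
    rw [← real_inner_self_eq_norm_sq, inner_radialVector hdeg]
    simp_rw [sum_hangingWeight_mul_truncatedGeom_sq]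
    rw [sum_comm]
    refine sum_congr rfl fun k _ ↦ ?_
    rw [← sum_filter, ← mul_sum, sum_add_distrib, ← sum_div, ← sum_mul, sum_sub_distrib]
    simp [mul_comm]
  · have : ({w | G.edist v w = (0 : ℕ)} : Finset V) = {v} := by
      ext; simp [@eq_comm _ v]
    rw [this, card_singleton, Nat.cast_one]
  · have : ({w | G.edist v w = (0 : ℕ)} : Finset V) = {v} := by
      ext; simp [@eq_comm _ v]
    rw [this, sum_singleton]
    exact_mod_cast G.card_sphere_le_degree v
  · intro k hk
    exact_mod_cast G.card_sphere_add_card_sphere_le_sum_degree v hk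

open scoped Classical in
lemma Adj.le_sum_hangingWeight {u v : V} (huv : G.Adj u v) {M : ℕ}
    (hM : ((2 * M + 3 : ℕ) : ℕ∞) < G.egirth) :
    ((M + 1 : ℕ) : ℝ) ≤ ∑ w, ∑ k ∈ range (M + 1),
          (if G.edist u w = k ∧ G.edist v w = (k + 1 : ℕ) then
            (1 / 2 : ℝ) ^ k * (1 + (3 - G.degree w) * (M - k) / 2) else 0) := by
  have h := le_sum_sphere
    (s := fun k ↦ #{w | G.edist u w = k ∧ G.edist v w = (k + 1 : ℕ)})
    (D := fun k ↦ ∑ w with G.edist u w = k ∧ G.edist v w = (k + 1 : ℕ), (G.degree w : ℝ))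
    (M + 1) ?_ ?_
  · refine h.trans (le_of_eq ?_)
    rw [sum_comm]
    refine sum_congr rfl fun k _ ↦ ?_
    rw [← sum_filter, ← mul_sum, sum_add_distrib, ← sum_div, ← sum_mul, sum_sub_distrib]
    simp [mul_comm]
  · have : ({w | G.edist u w = (0 : ℕ) ∧ G.edist v w = (0 + 1 : ℕ)} : Finset V) = {u} := by
      ext w
      simp only [Nat.cast_zero, edist_eq_zero_iff, zero_add, Nat.cast_one, edist_eq_one_iff_adj,
        mem_filter, mem_univ, true_and, mem_singleton]
      constructor
      · exact fun h ↦ h.1.symm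
      · rintro rfl
        exact ⟨rfl, huv.symm⟩
    rw [this, card_singleton, Nat.cast_one]
  · intro k hk
    exact_mod_cast huv.sum_degree_le (lt_of_le_of_lt (by exact_mod_cast (by omega)) hM)

lemma Adj.inner_radialVector_le (hdeg : ∀ v, G.degree v ≤ 3) {u v : V} (huv : G.Adj u v) {M : ℕ}
    (hM : ((2 * M + 3 : ℕ) : ℕ∞) < G.egirth) :
    inner ℝ (G.radialVector (M + 1) u) (G.radialVector (M + 1) v) ≤ -√2 * (M + 1 : ℕ) := by
  classical
  rw [inner_radialVector hdeg]
  simp_rw [huv.sum_hangingWeight_mul_truncatedGeom _ _ hM]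
  rw [← mul_sum, sum_add_distrib]
  have h1 := huv.le_sum_hangingWeight hM
  have h2 := huv.symm.le_sum_hangingWeight hM
  have h3 : √2 = √(1 / 2) * 2 := by
    rw [Real.sqrt_eq_iff_mul_self_eq (by norm_num) (by positivity), mul_mul_mul_comm,
      Real.mul_self_sqrt (by norm_num)]
    norm_num
  have h4 := mul_le_mul_of_nonneg_left (add_le_add h1 h2) (Real.sqrt_nonneg (1 / 2))
  rw [h3]
  linarith

lemma Adj.le_angle_radialVector (hdeg : ∀ v, G.degree v ≤ 3) {u v : V} (huv : G.Adj u v)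
    (hgirth : (655 : ℕ∞) ≤ G.egirth) :
    G.radialVector 326 u ≠ 0 ∧ G.radialVector 326 v ≠ 0 ∧
      0.89 * Real.pi ≤
        InnerProductGeometry.angle (G.radialVector 326 u) (G.radialVector 326 v) := by
  have h := huv.inner_radialVector_le hdeg (M := 325) (lt_of_lt_of_le (by norm_num) hgirth)
  have hu := norm_sq_radialVector_le hdeg 326 u
  have hv := norm_sq_radialVector_le hdeg 326 v
  norm_num at h hu hv
  have h2 : 1.414213 < √2 := Real.lt_sqrt_of_sq_lt (by norm_num)
  have hneg : inner ℝ (G.radialVector 326 u) (G.radialVector 326 v) ≤ -461.033 := by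
    norm_num at h2 ⊢; linarith
  have hu0 : G.radialVector 326 u ≠ 0 := fun h0 ↦ by
    rw [h0, inner_zero_left] at hneg; norm_num at hneg
  have hv0 : G.radialVector 326 v ≠ 0 := fun h0 ↦ by
    rw [h0, inner_zero_right] at hneg; norm_num at hneg
  refine ⟨hu0, hv0, ?_⟩
  have hpos : 0 < ‖G.radialVector 326 u‖ * ‖G.radialVector 326 v‖ := by positivity
  have hle : ‖G.radialVector 326 u‖ * ‖G.radialVector 326 v‖ ≤ 490 := by
    nlinarith [sq_nonneg (‖G.radialVector 326 u‖ - ‖G.radialVector 326 v‖)]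
  have hcos : Real.cos (0.89 * Real.pi) = -Real.cos (0.11 * Real.pi) := by
    rw [← Real.cos_pi_sub]; ring_nf
  have hπ := Real.pi_pos
  rw [InnerProductGeometry.angle, ← Real.arccos_cos (x := 0.89 * Real.pi) (by positivity)
    (by linarith)]
  refine Real.arccos_le_arccos ?_
  rw [hcos, div_le_iff₀ hpos]
  have := cos_eleven_hundredths_pi_le
  have hc : 0 ≤ Real.cos (0.11 * Real.pi) :=
    Real.cos_nonneg_of_neg_pi_div_two_le_of_le (by linarith) (by linarith)
  have := mul_le_mul this hle hpos.le (by norm_num)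
  norm_num at *
  linarith

end Embedding

end SimpleGraph

/-- If `G` is a finite graph of maximum degree at most `3` and girth at least `655`,
then there is a probability measure on `V → {0,1}` (all subsets measurable) giving each
edge probability at least `0.89` of being cut. -/
theorem exists_random_edge_cut_cubic {V : Type*} [Fintype V]
    (G : SimpleGraph V) (hdeg : ∀ v : V, (G.neighborSet v).ncard ≤ 3)
    (hgirth : (655 : ℕ∞) ≤ G.egirth) :
    letI : MeasurableSpace (V → Bool) := ⊤
    ∃ μ : Measure (V → Bool), IsProbabilityMeasure μ ∧
      ∀ u v : V, G.Adj u v →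
        ENNReal.ofReal (0.89 : ℝ) ≤ μ {f : V → Bool | f u ≠ f v} := by
  classical
  let _ : MeasurableSpace (V → Bool) := ⊤
  have hdeg' : ∀ v, G.degree v ≤ 3 := fun v ↦ by
    rw [← SimpleGraph.card_neighborSet_eq_degree, ← Nat.card_eq_fintype_card]
    exact hdeg v
  set F : EuclideanSpace ℝ (V × Fin (326 + 1)) → V → Bool :=
    fun g v ↦ decide (0 ≤ inner ℝ (G.radialVector 326 v) g) with hF
  have hFm : Measurable F := by
    refine measurable_to_countable' fun f ↦ ?_
    have : F ⁻¹' {f} =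
        ⋂ v, {g | 0 ≤ inner ℝ (G.radialVector 326 v) g ↔ f v = true} := by
      ext g
      simp only [Set.mem_preimage, Set.mem_singleton_iff, funext_iff, Set.mem_iInter]
      exact forall_congr' fun v ↦ by cases f v <;> simp [hF]
    rw [this]
    exact MeasurableSet.iInter fun v ↦
      (measurableSet_le (by fun_prop) (by fun_prop)).iff (MeasurableSet.const _)
  refine ⟨(ProbabilityTheory.stdGaussian _).map F,
    Measure.isProbabilityMeasure_map hFm.aemeasurable, fun u v huv ↦ ?_⟩
  obtain ⟨hu, hv, hangle⟩ := huv.le_angle_radialVector hdeg' hgirth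
  have hπ := Real.pi_pos
  rw [Measure.map_apply hFm (MeasurableSpace.measurableSet_top)]
  have hset : F ⁻¹' {f | f u ≠ f v} = {g | ¬ (0 ≤ inner ℝ (G.radialVector 326 u) g ↔
      0 ≤ inner ℝ (G.radialVector 326 v) g)} := by
    ext g
    simp [hF]
  rw [hset]
  refine le_trans (ENNReal.ofReal_le_ofReal ?_)
    (ofReal_angle_div_pi_le_stdGaussian hu hv (by linarith))
  rwa [le_div_iff₀ hπ]
end
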